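/- arXiv:1907.01603 — 2 statements merged into one kernel-verified Lean document; each statement's English description precedes it below -/
import Mathlib

section
/- Let s ≥ 4 and 3 ≤ r ≤ 2s - 4, and set k = ⌊r/2⌋. For every real ε > 0 there exists n₀ such that for all n ≥ n₀: every K_s-saturated graph on n vertices that has the minimum number of copies of C_r among all n-vertex K_s-saturated graphs contains at least (1 - ε)·C(n, k) independent sets of size k. -/
open SimpleGraph Finset

variable {V : Type*}

/-- The graph `G` with the edge `u v` added. -/
def addEdge (G : SimpleGraph V) (u v : V) : SimpleGraph V :=
  G ⊔ SimpleGraph.fromEdgeSet {s(u, v)}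

/-- `G` is `K_s`-saturated: `G` is `K_s`-free and adding any missing edge creates a `K_s`. -/
def KSat (s : ℕ) (G : SimpleGraph V) : Prop :=
  G.CliqueFree s ∧ ∀ u v : V, u ≠ v → ¬ G.Adj u v → ¬ (addEdge G u v).CliqueFree s

/-- The number of copies of `K_r` in `G`: the number of `r`-sets of vertices inducing
a complete graph. -/
noncomputable def cliqueCount (G : SimpleGraph V) (r : ℕ) : ℕ :=
  {t : Finset V | G.IsNClique r t}.ncard

/-- `sat(n, K_r, K_s)`: minimum number of copies of `K_r` in an `n`-vertex
`K_s`-saturated graph. -/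
noncomputable def satCliques (n r s : ℕ) : ℕ :=
  sInf {m | ∃ G : SimpleGraph (Fin n), KSat s G ∧ cliqueCount G r = m}

/-- The join `K_{s-2} ∗ ∅_{n-s+2}` on `Fin n`. -/
def joinGraph (n s : ℕ) : SimpleGraph (Fin n) :=
  SimpleGraph.fromRel (fun i _ => (i : ℕ) < s - 2)

/-- The number of copies of `C_r` in `G` : the number of subgraphs of `G`
isomorphic to the cycle on `r` vertices. -/
noncomputable def cycleCount (G : SimpleGraph V) (r : ℕ) : ℕ :=
  {H : G.Subgraph | Nonempty (H.coe ≃g cycleGraph r)}.ncard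

/-- `sat(n, C_r, K_s)`. -/
noncomputable def satCyclesCliqueSat (n r s : ℕ) : ℕ :=
  sInf {m | ∃ G : SimpleGraph (Fin n), KSat s G ∧ cycleCount G r = m}

/-- `G` contains a copy of `F`, i.e. a subgraph isomorphic to `F`. -/
def ContainsCopy {α β : Type*} (F : SimpleGraph α) (G : SimpleGraph β) : Prop :=
  ∃ f : α → β, Function.Injective f ∧ ∀ a b : α, F.Adj a b → G.Adj (f a) (f b)

/-- strongly K_s-saturated -/
def StronglyKSat (s : ℕ) (G : SimpleGraph V) : Prop :=
  ∀ u v : V, u ≠ v → ¬ G.Adj u v →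
    ∃ t : Finset V, (addEdge G u v).IsNClique s t ∧ u ∈ t ∧ v ∈ t

/-- dumbbell -/
def dumbbell (m : ℕ) : SimpleGraph (Fin (2 * m)) :=
  SimpleGraph.fromRel (fun i j =>
    ((i : ℕ) < m ∧ (j : ℕ) < m) ∨ (m ≤ (i : ℕ) ∧ m ≤ (j : ℕ)) ∨ ((i : ℕ) = 0 ∧ (j : ℕ) = m))

def Vgraph (m : ℕ) : SimpleGraph (Fin (m + 2)) :=
  SimpleGraph.fromRel (fun i j =>
    ((i : ℕ) < m ∧ (j : ℕ) < m) ∨ ((i : ℕ) = 0 ∧ m ≤ (j : ℕ)))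

def lambdaGraph (m : ℕ) : SimpleGraph (Fin (m + 1)) :=
  SimpleGraph.fromRel (fun i j =>
    ((i : ℕ) < m ∧ (j : ℕ) < m) ∨ ((i : ℕ) = m ∧ (j : ℕ) < 2))

def VgraphGen (m r : ℕ) : SimpleGraph (Fin (m + (m - r))) :=
  SimpleGraph.fromRel (fun i j =>
    ((i : ℕ) < m ∧ (j : ℕ) < m) ∨
      (((i : ℕ) = 0 ∨ m ≤ (i : ℕ)) ∧ ((j : ℕ) = 0 ∨ m ≤ (j : ℕ))))

def lambdaGraphGen (m r : ℕ) : SimpleGraph (Fin (m + 1)) :=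
  SimpleGraph.fromRel (fun i j =>
    ((i : ℕ) < m ∧ (j : ℕ) < m) ∨ ((i : ℕ) = m ∧ (j : ℕ) < r))

/-- `G` is saturated with respect to the family `{F₁, F₂, F₃}`. -/
def FamSat3 {α₁ α₂ α₃ : Type*} (F₁ : SimpleGraph α₁) (F₂ : SimpleGraph α₂)
    (F₃ : SimpleGraph α₃) (G : SimpleGraph V) : Prop :=
  ¬ ContainsCopy F₁ G ∧ ¬ ContainsCopy F₂ G ∧ ¬ ContainsCopy F₃ G ∧
    ∀ u v : V, u ≠ v → ¬ G.Adj u v →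
      ContainsCopy F₁ (addEdge G u v) ∨ ContainsCopy F₂ (addEdge G u v) ∨
        ContainsCopy F₃ (addEdge G u v)

noncomputable def satFam3 {α₁ α₂ α₃ : Type*} (n : ℕ) (F₁ : SimpleGraph α₁)
    (F₂ : SimpleGraph α₂) (F₃ : SimpleGraph α₃) : ℕ :=
  sInf {m | ∃ G : SimpleGraph (Fin n), FamSat3 F₁ F₂ F₃ G ∧ G.edgeSet.ncard = m}

noncomputable def satCliquesFam3 {α₁ α₂ α₃ : Type*} (n r : ℕ) (F₁ : SimpleGraph α₁)
    (F₂ : SimpleGraph α₂) (F₃ : SimpleGraph α₃) : ℕ :=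
  sInf {m | ∃ G : SimpleGraph (Fin n), FamSat3 F₁ F₂ F₃ G ∧ cliqueCount G r = m}

/-- saturation w.r.t. a single graph, with copies as subgraphs. -/
def SatGraph {α : Type*} (F : SimpleGraph α) (G : SimpleGraph V) : Prop :=
  ¬ ContainsCopy F G ∧ ∀ u v : V, u ≠ v → ¬ G.Adj u v → ContainsCopy F (addEdge G u v)

noncomputable def satCyclesGraphSat {α : Type*} (n r : ℕ) (F : SimpleGraph α) : ℕ :=
  sInf {m | ∃ G : SimpleGraph (Fin n), SatGraph F G ∧ cycleCount G r = m}

/-- number of independent sets of size l -/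
noncomputable def indepCount (G : SimpleGraph V) (l : ℕ) : ℕ :=
  {t : Finset V | t.card = l ∧ ∀ a ∈ t, ∀ b ∈ t, ¬ G.Adj a b}.ncard

/-- Ramsey number -/
noncomputable def ramsey (l s : ℕ) : ℕ :=
  sInf {N | ∀ G : SimpleGraph (Fin N),
    (∃ t : Finset (Fin N), t.card = l ∧ ∀ a ∈ t, ∀ b ∈ t, ¬ G.Adj a b) ∨
      ∃ t : Finset (Fin N), G.IsNClique s t}

/-- The labelled copies of `C_r` in `G`, as maps on the vertices. -/
noncomputable def cycleMaps [Fintype V] (G : SimpleGraph V) (r : ℕ) : Finset (Fin r → V) := by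
  classical exact {f | Function.Injective f ∧ ∀ a b, (cycleGraph r).Adj a b → G.Adj (f a) (f b)}

lemma mem_cycleMaps [Fintype V] {G : SimpleGraph V} {r : ℕ} {f : Fin r → V} :
    f ∈ cycleMaps G r ↔
      Function.Injective f ∧ ∀ a b, (cycleGraph r).Adj a b → G.Adj (f a) (f b) := by
  simp [cycleMaps]

lemma cycleCount_eq_ncard_range [Fintype V] (G : SimpleGraph V) (r : ℕ) :
    cycleCount G r = (Set.range (Copy.toSubgraph (A := cycleGraph r) (B := G))).ncard := by
  rw [Copy.range_toSubgraph, cycleCount]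
  congr 1
  ext H
  exact ⟨fun ⟨e⟩ => ⟨e.symm⟩, fun ⟨e⟩ => ⟨e.symm⟩⟩

lemma cycleCount_le_card_cycleMaps [Fintype V] (G : SimpleGraph V) (r : ℕ) :
    cycleCount G r ≤ #(cycleMaps G r) := by
  classical
  rw [cycleCount_eq_ncard_range]
  choose c hc using fun H : Set.range (Copy.toSubgraph (A := cycleGraph r) (B := G)) => H.2
  rw [← Nat.card_coe_set_eq, ← Nat.card_eq_finsetCard]
  refine Nat.card_le_card_of_injective
    (fun H => ⟨c H, mem_cycleMaps.2 ⟨(c H).injective, fun a b h => (c H).toHom.map_adj h⟩⟩) ?_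
  intro H H' h
  have : c H = c H' := by
    ext a
    exact congrFun (congrArg Subtype.val h) a
  rw [Subtype.ext_iff, ← hc H, ← hc H', this]

lemma card_cycleMaps_le [Fintype V] (G : SimpleGraph V) (r : ℕ) :
    #(cycleMaps G r) ≤ r ^ r * cycleCount G r := by
  classical
  let c : {f // f ∈ cycleMaps G r} → Copy (cycleGraph r) G := fun f =>
    ⟨⟨f.1, fun {a b} h => (mem_cycleMaps.1 f.2).2 a b h⟩, (mem_cycleMaps.1 f.2).1⟩
  obtain ⟨T, hT⟩ := (Set.toFinite
    (Set.range (Copy.toSubgraph (A := cycleGraph r) (B := G)))).exists_finset_coe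
  rw [cycleCount_eq_ncard_range, ← hT, Set.ncard_coe_finset, ← card_attach]
  have hmem : ∀ f ∈ (cycleMaps G r).attach, (c f).toSubgraph ∈ T := by
    intro f _
    rw [← mem_coe, hT]
    exact ⟨c f, rfl⟩
  refine card_le_mul_card_image_of_maps_to hmem _ ?_
  intro H hH
  rw [← mem_coe, hT] at hH
  obtain ⟨e, rfl⟩ := hH
  have hcard : #(univ.image fun i => e i) = r := by
    rw [card_image_of_injective (f := fun i => e i) _ e.injective]; simp
  have : #(Fintype.piFinset fun _ : Fin r => univ.image fun i => e i) = r ^ r := by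
    simp [hcard]
  rw [← this]
  refine card_le_card_of_injOn Subtype.val ?_ Subtype.val_injective.injOn
  intro f hf
  have hf' : (c f).toSubgraph = e.toSubgraph := (mem_filter.1 hf).2
  simp only [mem_coe, Fintype.mem_piFinset, mem_image, mem_univ, true_and]
  intro i
  have h1 : f.1 i ∈ (c f).toSubgraph.verts := ⟨i, by simp, rfl⟩
  rw [hf'] at h1
  obtain ⟨j, -, hj⟩ := h1
  exact ⟨j, hj⟩

lemma joinGraph_adj {n s : ℕ} {i j : Fin n} :
    (joinGraph n s).Adj i j ↔ i ≠ j ∧ ((i : ℕ) < s - 2 ∨ (j : ℕ) < s - 2) := by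
  simp [joinGraph]

lemma kSat_joinGraph {n s : ℕ} (hs : 2 ≤ s) : KSat s (joinGraph n s) := by
  classical
  constructor
  · intro t ht
    have h1 : #(t.filter fun i : Fin n => (i : ℕ) < s - 2) ≤ s - 2 := by
      calc _ ≤ #(range (s - 2)) := card_le_card_of_injOn (fun i : Fin n => (i : ℕ))
            (fun i hi => mem_coe.2 (mem_range.2 (mem_filter.1 hi).2)) Fin.val_injective.injOn
        _ = _ := card_range _
    have h2 : #(t.filter fun i : Fin n => ¬ (i : ℕ) < s - 2) ≤ 1 := by
      rw [card_le_one]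
      intro a ha b hb
      by_contra hab
      have := ht.1 (mem_filter.1 ha).1 (mem_filter.1 hb).1 hab
      rw [joinGraph_adj] at this
      exact this.2.elim (mem_filter.1 ha).2 (mem_filter.1 hb).2
    have := card_filter_add_card_filter_not (s := t) (fun i : Fin n => (i : ℕ) < s - 2)
    have := ht.2
    omega
  · intro u v huv hadj hfree
    have hu : ¬ (u : ℕ) < s - 2 := fun h => hadj (joinGraph_adj.2 ⟨huv, .inl h⟩)
    have hv : ¬ (v : ℕ) < s - 2 := fun h => hadj (joinGraph_adj.2 ⟨huv, .inr h⟩)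
    have hn : s - 2 ≤ n := by have := u.2; omega
    let A : Finset (Fin n) := univ.map (Fin.castLEEmb hn)
    have hA : ∀ x ∈ A, (x : ℕ) < s - 2 := by
      intro x hx
      obtain ⟨y, -, rfl⟩ := mem_map.1 hx
      simp
    refine hfree (insert u (insert v A)) ⟨?_, ?_⟩
    · intro a ha b hb hab
      simp only [coe_insert, Set.mem_insert_iff, mem_coe] at ha hb
      simp only [addEdge, sup_adj, joinGraph_adj, fromEdgeSet_adj, Set.mem_singleton_iff,
        Sym2.eq_iff]
      refine (em ((a : ℕ) < s - 2 ∨ (b : ℕ) < s - 2)).imp (fun h => ⟨hab, h⟩) fun h => ⟨?_, hab⟩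
      have := hA a
      have := hA b
      grind
    · rw [card_insert_of_notMem, card_insert_of_notMem]
      · simp [A]; omega
      · exact fun h => hv (hA _ h)
      · simp only [mem_insert, not_or]
        exact ⟨huv, fun h => hu (hA _ h)⟩

lemma two_mul_card_le_of_forall_cycleGraph_adj {r : ℕ} (hr : 2 ≤ r) (I : Finset (Fin r))
    (hI : ∀ a b, (cycleGraph r).Adj a b → a ∈ I → b ∉ I) : 2 * #I ≤ r := by
  obtain ⟨m, rfl⟩ := Nat.exists_eq_add_of_le' hr
  have h : #I ≤ #Iᶜ := by
    refine card_le_card_of_injOn (fun i => i + 1) ?_ (add_left_injective 1).injOn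
    intro i hi
    simpa using hI i (i + 1) (cycleGraph_adj.2 (.inr (by simp))) hi
  rw [card_compl, Fintype.card_fin] at h
  have := card_le_univ I
  rw [Fintype.card_fin] at this
  omega

lemma card_cycleMaps_joinGraph_le {n s r : ℕ} (hr : 2 ≤ r) (hn : 1 ≤ n) (hs : 1 ≤ s) :
    #(cycleMaps (joinGraph n s) r) ≤ 2 ^ r * s ^ r * n ^ (r / 2) := by
  classical
  let S : Finset (Fin n) := univ.filter fun v => (v : ℕ) < s - 2
  have hS : #S ≤ s := by
    calc _ ≤ #(range (s - 2)) := card_le_card_of_injOn (fun i : Fin n => (i : ℕ))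
            (fun i hi => mem_coe.2 (mem_range.2 (mem_filter.1 hi).2)) Fin.val_injective.injOn
      _ ≤ s := by simp
  let P : Finset (Fin r) → Finset (Fin r → Fin n) := fun I =>
    Fintype.piFinset fun i => if i ∈ I then univ else S
  have hsub : cycleMaps (joinGraph n s) r ⊆
      (univ.filter fun I : Finset (Fin r) => 2 * #I ≤ r).biUnion P := by
    intro f hf
    obtain ⟨-, hadj⟩ := mem_cycleMaps.1 hf
    refine mem_biUnion.2 ⟨({i | ¬ (f i : ℕ) < s - 2} : Finset (Fin r)), ?_, ?_⟩
    · refine mem_filter.2 ⟨mem_univ _, two_mul_card_le_of_forall_cycleGraph_adj hr _ ?_⟩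
      intro a b hab ha hb
      have := joinGraph_adj.1 (hadj a b hab)
      simp only [mem_filter, mem_univ, true_and] at ha hb
      tauto
    · simp only [P, Fintype.mem_piFinset]
      intro i
      split_ifs with h
      · simp
      · exact mem_filter.2
          ⟨mem_univ _, by simpa only [mem_filter, mem_univ, true_and, not_not] using h⟩
  have hP : ∀ I ∈ (univ.filter fun I : Finset (Fin r) => 2 * #I ≤ r),
      #(P I) ≤ s ^ r * n ^ (r / 2) := by
    intro I hI
    have hI' : #I ≤ r / 2 := by have := (mem_filter.1 hI).2; omega
    have hle : ∀ i : Fin r, #(if i ∈ I then (univ : Finset (Fin n)) else S) ≤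
        s * (if i ∈ I then n else 1) := by
      intro i
      split_ifs
      · simpa using Nat.le_mul_of_pos_left n hs
      · simpa using hS
    calc #(P I) = ∏ i, #(if i ∈ I then (univ : Finset (Fin n)) else S) :=
          Fintype.card_piFinset _
      _ ≤ ∏ i : Fin r, s * (if i ∈ I then n else 1) := prod_le_prod' fun i _ => hle i
      _ = s ^ r * n ^ #I := by rw [prod_mul_distrib]; simp
      _ ≤ _ := by gcongr
  calc _ ≤ _ := card_le_card hsub
    _ ≤ _ := card_biUnion_le_card_mul _ _ _ hP
    _ ≤ 2 ^ r * (s ^ r * n ^ (r / 2)) := by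
      gcongr
      exact (card_le_univ _).trans (by simp)
    _ = _ := by ring

lemma card_le_pow_of_forall_eqOn [Fintype V] {m : ℕ} (i : Fin m) (S : Finset (Fin m → V))
    (h : ∀ f ∈ S, ∀ g ∈ S, (∀ j, j ≠ i → f j = g j) → f = g) :
    #S ≤ Fintype.card V ^ (m - 1) := by
  classical
  calc #S ≤ #(univ : Finset ({j // j ≠ i} → V)) :=
        card_le_card_of_injOn (fun f j => f j) (by simp) fun f hf g hg hfg =>
          h f hf g hg fun j hj => congrFun hfg ⟨j, hj⟩
    _ = _ := by simp [Fintype.card_subtype_compl]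

lemma card_filter_pair_mem_le [Fintype V] [DecidableEq V] {m : ℕ} {a b : Fin m} (hab : a ≠ b)
    (B : Finset (V × V)) :
    #(univ.filter fun f : Fin m → V => (f a, f b) ∈ B) ≤ #B * Fintype.card V ^ (m - 2) := by
  calc _ ≤ #(B ×ˢ (univ : Finset ({j // ¬ (j = a ∨ j = b)} → V))) := by
        refine card_le_card_of_injOn (fun f => ((f a, f b), fun j => f j)) ?_ ?_
        · intro f hf
          simpa using hf
        · intro f _ g _ hfg
          simp only [Prod.mk.injEq] at hfg
          ext j
          by_cases hj : j = a ∨ j = b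
          · rcases hj with rfl | rfl
            exacts [hfg.1.1, hfg.1.2]
          · exact congrFun hfg.2 ⟨j, hj⟩
    _ = _ := by
        rw [card_product, card_univ, Fintype.card_fun, Fintype.card_subtype_compl,
          Fintype.card_subtype, Fintype.card_fin]
        congr 3
        rw [filter_or, filter_eq', filter_eq']
        simp [card_pair hab]

lemma card_filter_not_injective_le [Fintype V] [DecidableEq V] (m : ℕ) :
    #(univ.filter fun f : Fin m → V => ¬ Function.Injective f) ≤
      m * m * Fintype.card V ^ (m - 1) := by
  let P : Fin m × Fin m → Finset (Fin m → V) := fun p =>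
    univ.filter fun f => p.1 ≠ p.2 ∧ f p.1 = f p.2
  have hsub : (univ.filter fun f : Fin m → V => ¬ Function.Injective f) ⊆ univ.biUnion P := by
    intro f hf
    simp only [mem_filter, mem_univ, true_and, Function.Injective, not_forall] at hf
    obtain ⟨i, j, hij, hne⟩ := hf
    exact mem_biUnion.2 ⟨(i, j), mem_univ _, mem_filter.2 ⟨mem_univ _, hne, hij⟩⟩
  have hP : ∀ p ∈ univ, #(P p) ≤ Fintype.card V ^ (m - 1) := by
    intro p _
    refine card_le_pow_of_forall_eqOn p.1 _ fun f hf g hg hfg => ?_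
    obtain ⟨-, hne, hf⟩ := mem_filter.1 hf
    obtain ⟨-, -, hg⟩ := mem_filter.1 hg
    ext j
    by_cases hj : j = p.1
    · rw [hj, hf, hg, hfg _ hne.symm]
    · exact hfg j hj
  calc _ ≤ _ := card_le_card hsub
    _ ≤ _ := card_biUnion_le_card_mul _ _ _ hP
    _ = _ := by simp

lemma card_filter_exists_eq_le [Fintype V] [DecidableEq V] {m : ℕ} (a b : Fin m)
    (h : V → V → V) :
    #(univ.filter fun f : Fin m → V => ∃ i, i ≠ a ∧ i ≠ b ∧ f i = h (f a) (f b)) ≤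
      m * Fintype.card V ^ (m - 1) := by
  let P : Fin m → Finset (Fin m → V) := fun i =>
    univ.filter fun f => i ≠ a ∧ i ≠ b ∧ f i = h (f a) (f b)
  have hsub : (univ.filter fun f : Fin m → V => ∃ i, i ≠ a ∧ i ≠ b ∧ f i = h (f a) (f b)) ⊆
      univ.biUnion P := by
    intro f hf
    obtain ⟨i, hi⟩ := (mem_filter.1 hf).2
    exact mem_biUnion.2 ⟨i, mem_univ _, mem_filter.2 ⟨mem_univ _, hi⟩⟩
  have hP : ∀ i ∈ univ, #(P i) ≤ Fintype.card V ^ (m - 1) := by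
    intro i _
    refine card_le_pow_of_forall_eqOn i _ fun f hf g hg hfg => ?_
    obtain ⟨-, ha, hb, hf⟩ := mem_filter.1 hf
    obtain ⟨-, -, -, hg⟩ := mem_filter.1 hg
    ext j
    by_cases hj : j = i
    · rw [hj, hf, hg, hfg _ ha.symm, hfg _ hb.symm]
    · exact hfg j hj
  calc _ ≤ _ := card_le_card hsub
    _ ≤ _ := card_biUnion_le_card_mul _ _ _ hP
    _ = _ := by simp

/-- Sidorenko's inequality for the four-cycle. -/
lemma sum_pow_four_le [Fintype V] (a : V → V → ℕ) (ha : ∀ x y, a x y = a y x) :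
    (∑ x, ∑ y, a x y) ^ 4 ≤ Fintype.card V ^ 4 *
      ∑ x, ∑ y, a x y * ∑ u, ∑ v, a x u * a u v * a v y := by
  have h1 : (∑ x, ∑ y, a x y) ^ 2 ≤ Fintype.card V * ∑ x, ∑ y, ∑ u, a u x * a u y := by
    calc _ ≤ Fintype.card V * ∑ x, (∑ y, a x y) ^ 2 := sq_sum_le_card_mul_sum_sq
      _ = _ := by
        congr 1
        simp_rw [sq, sum_mul_sum]
        rw [sum_comm]
        refine sum_congr rfl fun x _ => ?_
        rw [sum_comm]
  have h2 : (∑ x, ∑ y, ∑ u, a u x * a u y) ^ 2 ≤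
      Fintype.card V ^ 2 * ∑ x, ∑ y, (∑ u, a u x * a u y) ^ 2 := by
    calc _ ≤ Fintype.card V * ∑ x, (∑ y, ∑ u, a u x * a u y) ^ 2 := sq_sum_le_card_mul_sum_sq
      _ ≤ Fintype.card V * ∑ x, Fintype.card V * ∑ y, (∑ u, a u x * a u y) ^ 2 := by
        gcongr
        exact sq_sum_le_card_mul_sum_sq
      _ = _ := by rw [← mul_sum]; ring
  have h3 : ∑ x, ∑ y, (∑ u, a u x * a u y) ^ 2 =
      ∑ x, ∑ y, a x y * ∑ u, ∑ v, a x u * a u v * a v y := by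
    calc _ = ∑ x, ∑ u, ∑ y, ∑ v, a y x * a y u * (a v x * a v u) := by
          simp_rw [sq, sum_mul_sum]
      _ = ∑ x, ∑ y, ∑ u, ∑ v, a y x * a y u * (a v x * a v u) :=
          sum_congr rfl fun x _ => sum_comm
      _ = _ := by
          refine sum_congr rfl fun x _ => sum_congr rfl fun y _ => ?_
          simp_rw [mul_sum]
          rw [sum_comm]
          refine sum_congr rfl fun u _ => sum_congr rfl fun v _ => ?_
          rw [ha y x, ha u x, ha v y]
          ring
  calc (∑ x, ∑ y, a x y) ^ 4 = ((∑ x, ∑ y, a x y) ^ 2) ^ 2 := by ring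
    _ ≤ (Fintype.card V * ∑ x, ∑ y, ∑ u, a u x * a u y) ^ 2 := by gcongr
    _ = Fintype.card V ^ 2 * (∑ x, ∑ y, ∑ u, a u x * a u y) ^ 2 := by ring
    _ ≤ Fintype.card V ^ 2 *
        (Fintype.card V ^ 2 * ∑ x, ∑ y, (∑ u, a u x * a u y) ^ 2) := by gcongr
    _ = _ := by rw [h3]; ring

lemma exists_subset_forall_lt_degree [DecidableEq V] (G : SimpleGraph V) [DecidableRel G.Adj]
    (D : ℕ) (W : Finset V) (hW : D * #W < ∑ x ∈ W, #(W.filter (G.Adj x))) :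
    ∃ U : Finset V, U.Nonempty ∧ ∀ x ∈ U, D < 2 * #(U.filter (G.Adj x)) := by
  induction hn : #W generalizing W with
  | zero =>
    rw [card_eq_zero] at hn
    simp [hn] at hW
  | succ n ih =>
    by_cases h : ∀ x ∈ W, D < 2 * #(W.filter (G.Adj x))
    · exact ⟨W, card_pos.1 (by omega), h⟩
    · push Not at h
      obtain ⟨x, hx, hD⟩ := h
      refine ih (W.erase x) ?_ (by rw [card_erase_of_mem hx, hn]; rfl)
      have hcard : #W = #(W.erase x) + 1 := by rw [card_erase_of_mem hx, hn]; rfl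
      have hsum : ∑ y ∈ W, #(W.filter (G.Adj y)) =
          ∑ y ∈ W.erase x, #((W.erase x).filter (G.Adj y)) + 2 * #(W.filter (G.Adj x)) := by
        obtain ⟨Z, hxZ, rfl⟩ : ∃ Z, x ∉ Z ∧ W = insert x Z :=
          ⟨W.erase x, notMem_erase _ _, (insert_erase hx).symm⟩
        simp only [card_filter, erase_insert hxZ, sum_insert hxZ, SimpleGraph.irrefl, if_false,
          sum_add_distrib, G.adj_comm _ x]
        ring
      rw [hsum, hcard] at hW
      nlinarith

/-- The homomorphisms to `G` from the path on `m` vertices with all vertices sent into `W`. -/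
def pathMaps [Fintype V] [DecidableEq V] (G : SimpleGraph V) [DecidableRel G.Adj]
    (W : Finset V) (m : ℕ) : Finset (Fin m → V) :=
  univ.filter fun f => (∀ i, f i ∈ W) ∧ ∀ i j : Fin m, (i : ℕ) + 1 = j → G.Adj (f i) (f j)

lemma mem_pathMaps [Fintype V] [DecidableEq V] {G : SimpleGraph V} [DecidableRel G.Adj]
    {W : Finset V} {m : ℕ} {f : Fin m → V} :
    f ∈ pathMaps G W m ↔
      (∀ i, f i ∈ W) ∧ ∀ i j : Fin m, (i : ℕ) + 1 = j → G.Adj (f i) (f j) := by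
  simp [pathMaps]

lemma pow_le_card_pathMaps [Fintype V] [DecidableEq V] (G : SimpleGraph V) [DecidableRel G.Adj]
    {W : Finset V} (hne : W.Nonempty) {D : ℕ} (hD : ∀ x ∈ W, D ≤ #(W.filter (G.Adj x)))
    (m : ℕ) : D ^ m ≤ #(pathMaps G W m) := by
  induction m with
  | zero =>
    rw [pow_zero, Nat.one_le_iff_ne_zero, ← Nat.pos_iff_ne_zero, card_pos]
    exact ⟨Fin.elim0, mem_pathMaps.2 ⟨fun i => i.elim0, fun i => i.elim0⟩⟩
  | succ m ih =>
    have hext : ∀ g ∈ pathMaps G W m, ∃ N : Finset V, D ≤ #N ∧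
        ∀ v ∈ N, (Fin.snoc g v : Fin (m + 1) → V) ∈ pathMaps G W (m + 1) := by
      intro g hg
      obtain ⟨hgW, hgA⟩ := mem_pathMaps.1 hg
      obtain ⟨N, hDN, hNW, hNA⟩ : ∃ N : Finset V, D ≤ #N ∧ N ⊆ W ∧
          ∀ v ∈ N, ∀ i : Fin m, (i : ℕ) + 1 = m → G.Adj (g i) v := by
        rcases Nat.eq_zero_or_pos m with rfl | hm
        · obtain ⟨x, hx⟩ := hne
          exact ⟨W, (hD x hx).trans (card_filter_le _ _), Subset.rfl, fun _ _ i => i.elim0⟩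
        · refine ⟨W.filter (G.Adj (g ⟨m - 1, by omega⟩)), hD _ (hgW _), filter_subset _ _, ?_⟩
          intro v hv i hi
          have : i = ⟨m - 1, by omega⟩ := by ext; simp; omega
          rw [this]
          exact (mem_filter.1 hv).2
      refine ⟨N, hDN, fun v hv => mem_pathMaps.2 ⟨?_, ?_⟩⟩
      · intro i
        induction i using Fin.lastCases with
        | last => simpa using hNW hv
        | cast i => simpa using hgW i
      · intro i j hij
        induction j using Fin.lastCases with
        | last =>
          induction i using Fin.lastCases with
          | last => simp at hij
          | cast i => simpa using hNA v hv i (by simpa using hij)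
        | cast j =>
          induction i using Fin.lastCases with
          | last => have := j.2; simp at hij; omega
          | cast i => simpa using hgA i j (by simpa using hij)
    rw [pow_succ']
    refine (Nat.mul_le_mul_left D ih).trans
      (mul_card_image_le_card_of_maps_to
        (f := fun f : Fin (m + 1) → V => (Fin.init f : Fin m → V)) ?_ D ?_)
    · intro f hf
      obtain ⟨hfW, hfA⟩ := mem_pathMaps.1 hf
      exact mem_pathMaps.2 ⟨fun i => hfW _, fun i j hij => hfA _ _ (by simpa using hij)⟩
    · intro g hg
      obtain ⟨N, hDN, hN⟩ := hext g hg
      refine hDN.trans (card_le_card_of_injOn (fun v => (Fin.snoc g v : Fin (m + 1) → V)) ?_ ?_)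
      · intro v hv
        exact mem_filter.2 ⟨hN v hv, by simp⟩
      · intro v _ w _ h
        simpa using congrFun h (Fin.last m)

lemma mem_cycleMaps_of_forall_add_one [Fintype V] {G : SimpleGraph V} {r : ℕ}
    {f : Fin (r + 2) → V} (hf : Function.Injective f) (h : ∀ i, G.Adj (f i) (f (i + 1))) :
    f ∈ cycleMaps G (r + 2) := by
  refine mem_cycleMaps.2 ⟨hf, fun a b hab => ?_⟩
  rcases cycleGraph_adj.1 hab with hab | hab
  · rw [sub_eq_iff_eq_add'.1 hab]
    exact (h b).symm
  · rw [sub_eq_iff_eq_add'.1 hab]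
    exact h a

lemma snoc_snoc_mem_cycleMaps [Fintype V] {G : SimpleGraph V} {m : ℕ} {f : Fin (m + 1) → V}
    (hf : Function.Injective f) (hadj : ∀ i j : Fin (m + 1), (i : ℕ) + 1 = j → G.Adj (f i) (f j))
    {u v : V} (hu : ∀ i, f i ≠ u) (hv : ∀ i, f i ≠ v) (h1 : G.Adj (f 0) u) (h2 : G.Adj u v)
    (h3 : G.Adj v (f (Fin.last m))) :
    (Fin.snoc (Fin.snoc f v : Fin (m + 2) → V) u : Fin (m + 3) → V) ∈ cycleMaps G (m + 3) := by
  refine mem_cycleMaps_of_forall_add_one ?_ fun i => ?_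
  · rw [Fin.snoc_injective_iff, Fin.snoc_injective_iff]
    refine ⟨⟨hf, ?_⟩, ?_⟩
    · rintro ⟨i, hi⟩
      exact hv i hi
    · rintro ⟨i, hi⟩
      induction i using Fin.lastCases with
      | last => exact h2.ne (by simpa using hi.symm)
      | cast i => exact hu i (by simpa using hi)
  · induction i using Fin.lastCases with
    | last =>
      rw [Fin.last_add_one, ← Fin.castSucc_zero, ← Fin.castSucc_zero]
      simpa only [Fin.snoc_last, Fin.snoc_castSucc] using h1.symm
    | cast i =>
      rw [Fin.coeSucc_eq_succ]
      induction i using Fin.lastCases with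
      | last =>
        rw [Fin.succ_last]
        simpa only [Fin.snoc_last, Fin.snoc_castSucc] using h2.symm
      | cast i =>
        rw [Fin.succ_castSucc]
        simp only [Fin.snoc_castSucc]
        induction i using Fin.lastCases with
        | last =>
          rw [Fin.succ_last]
          simpa only [Fin.snoc_last] using h3.symm
        | cast i =>
          rw [Fin.succ_castSucc]
          simp only [Fin.snoc_castSucc]
          exact hadj _ _ (by simp)

lemma KSat.exists_adj_adj_adj {G : SimpleGraph V} {s : ℕ} (hs : 4 ≤ s) (hG : KSat s G)
    {x y : V} (hxy : x ≠ y) (hadj : ¬ G.Adj x y) :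
    ∃ u v, G.Adj x u ∧ G.Adj u v ∧ G.Adj v y ∧ u ≠ y ∧ v ≠ x := by
  classical
  obtain ⟨t, ht⟩ := not_forall_not.1 (hG.2 x y hxy hadj)
  have hle : #(({x, y} : Finset V)) ≤ 2 := card_le_two
  have hcard : 1 < #(t \ {x, y}) := by
    have := le_card_sdiff {x, y} t
    have := ht.2
    omega
  obtain ⟨u, hu, v, hv, huv⟩ := one_lt_card.1 hcard
  simp only [mem_sdiff, mem_insert, mem_singleton, not_or] at hu hv
  have key : ∀ a ∈ t, ∀ b ∈ t, a ≠ b → b ≠ x → b ≠ y → G.Adj a b := by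
    intro a ha b hb hab hbx hby
    have := ht.1 ha hb hab
    simp only [addEdge, sup_adj, fromEdgeSet_adj, Set.mem_singleton_iff, Sym2.eq_iff] at this
    tauto
  have hx : x ∈ t := by
    by_contra hx
    refine hG.1 t ⟨fun a ha b hb hab => ?_, ht.2⟩
    have := ht.1 ha hb hab
    simp only [addEdge, sup_adj, fromEdgeSet_adj, Set.mem_singleton_iff, Sym2.eq_iff] at this
    have hax : a ≠ x := fun h => hx (h ▸ ha)
    have hbx : b ≠ x := fun h => hx (h ▸ hb)
    tauto
  have hy : y ∈ t := by
    by_contra hy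
    refine hG.1 t ⟨fun a ha b hb hab => ?_, ht.2⟩
    have := ht.1 ha hb hab
    simp only [addEdge, sup_adj, fromEdgeSet_adj, Set.mem_singleton_iff, Sym2.eq_iff] at this
    have hax : a ≠ y := fun h => hy (h ▸ ha)
    have hbx : b ≠ y := fun h => hy (h ▸ hb)
    tauto
  exact ⟨u, v, key x hx u hu.1 (Ne.symm hu.2.1) hu.2.1 hu.2.2,
    key u hu.1 v hv.1 huv hv.2.1 hv.2.2,
    (key y hy v hv.1 (Ne.symm hv.2.2) hv.2.1 hv.2.2).symm, hu.2.2, hv.2.1⟩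

section Counting

variable [Fintype V] (G : SimpleGraph V) [DecidableRel G.Adj]

/-- The inner edges of the walks of length three from `x` to `y`. -/
def middleEdges (x y : V) : Finset (V × V) :=
  univ.filter fun p => G.Adj x p.1 ∧ G.Adj p.1 p.2 ∧ G.Adj p.2 y

/-- The ordered pairs of adjacent vertices joined by at most `M` walks of length three. -/
def sparseEdges (M : ℕ) : Finset (V × V) :=
  univ.filter fun p => G.Adj p.1 p.2 ∧ #(middleEdges G p.1 p.2) ≤ M

lemma card_middleEdges_comm (x y : V) : #(middleEdges G x y) = #(middleEdges G y x) := by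
  refine card_bij (fun p _ => p.swap) ?_ ?_ ?_
  · intro p hp
    simpa [middleEdges, G.adj_comm, and_comm, and_left_comm] using hp
  · intro p _ q _ h
    exact Prod.swap_injective h
  · intro p hp
    exact ⟨p.swap, by simpa [middleEdges, G.adj_comm, and_comm, and_left_comm] using hp, by simp⟩

variable [DecidableEq V]

lemma card_sparseEdges_pow_three_le (M : ℕ) :
    #(sparseEdges G M) ^ 3 ≤ Fintype.card V ^ 4 * M := by
  set B := sparseEdges G M with hB
  let a : V → V → ℕ := fun x y => if (x, y) ∈ B then 1 else 0
  have ha : ∀ x y, a x y = a y x := by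
    intro x y
    simp only [a, hB, sparseEdges, mem_filter, mem_univ, true_and, G.adj_comm x y,
      card_middleEdges_comm G x y]
  have hsum : ∑ x, ∑ y, a x y = #B := by
    rw [← Fintype.sum_prod_type' (f := a)]
    simp [a]
  have hinner : ∀ x y, a x y * ∑ u, ∑ v, a x u * a u v * a v y ≤ a x y * M := by
    intro x y
    by_cases hxy : (x, y) ∈ B
    · refine Nat.mul_le_mul_left _ (le_trans ?_ (mem_filter.1 hxy).2.2)
      rw [← Fintype.sum_prod_type' (f := fun u v => a x u * a u v * a v y), middleEdges,
        card_filter]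
      refine sum_le_sum fun p _ => ?_
      have hG : ∀ x y, (x, y) ∈ B → G.Adj x y := fun x y h => (mem_filter.1 h).2.1
      simp only [a, ← ite_and, mul_ite, mul_one, mul_zero]
      split_ifs with h1 h2 <;> first | omega | skip
      exact absurd ⟨hG _ _ (by tauto), hG _ _ (by tauto), hG _ _ (by tauto)⟩ h2
    · simp [a, hxy]
  have h4 : #B ^ 4 ≤ Fintype.card V ^ 4 * (#B * M) := by
    rw [← hsum]
    refine (sum_pow_four_le a ha).trans (Nat.mul_le_mul_left _ ?_)
    rw [sum_mul]
    refine sum_le_sum fun x _ => ?_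
    rw [sum_mul]
    exact sum_le_sum fun y _ => hinner x y
  rcases Nat.eq_zero_or_pos #B with h0 | hpos
  · simp [h0]
  · refine Nat.le_of_mul_le_mul_left ?_ hpos
    calc #B * #B ^ 3 = #B ^ 4 := by ring
      _ ≤ _ := h4
      _ = _ := by ring

variable {G}

lemma exists_mem_middleEdges_of_lt {m : ℕ} (f : Fin m → V) {x y : V}
    (h : 2 * m * Fintype.card V < #(middleEdges G x y)) :
    ∃ p ∈ middleEdges G x y, (∀ i, f i ≠ p.1) ∧ ∀ i, f i ≠ p.2 := by
  by_contra! hcon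
  have hsub : middleEdges G x y ⊆ univ.image f ×ˢ univ ∪ univ ×ˢ univ.image f := by
    intro p hp
    have := hcon p hp
    simp only [mem_union, mem_product, mem_image, mem_univ, true_and, and_true]
    by_contra! h
    obtain ⟨i, hi⟩ := this h.1
    exact h.2 i hi
  have hf : #(univ.image f) ≤ m := card_image_le.trans (by simp)
  have := (card_le_card hsub).trans (card_union_le _ _)
  rw [card_product, card_product, card_univ] at this
  nlinarith

lemma card_pathMaps_le {s m : ℕ} (hs : 4 ≤ s) (hG : KSat s G) (W : Finset V) (hm : 1 ≤ m) :
    #(pathMaps G W (m + 1)) ≤ #(cycleMaps G (m + 3)) +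
      ((m + 1) * (m + 1) + 2 * (m + 1)) * Fintype.card V ^ m +
      #(sparseEdges G (2 * (m + 1) * Fintype.card V)) * Fintype.card V ^ (m - 1) := by
  have hex : ∀ x y, ∃ p : V × V, x ≠ y → ¬ G.Adj x y →
      G.Adj x p.1 ∧ G.Adj p.1 p.2 ∧ G.Adj p.2 y ∧ p.1 ≠ y ∧ p.2 ≠ x := by
    intro x y
    by_cases h : x ≠ y ∧ ¬ G.Adj x y
    · obtain ⟨u, v, h⟩ := hG.exists_adj_adj_adj hs h.1 h.2
      exact ⟨(u, v), fun _ _ => h⟩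
    · exact ⟨(x, y), fun h1 h2 => absurd ⟨h1, h2⟩ h⟩
  choose p hp using hex
  set B := sparseEdges G (2 * (m + 1) * Fintype.card V) with hB
  let A₁ := univ.filter fun f : Fin (m + 1) → V => ¬ Function.Injective f
  let A₂ := univ.filter fun f : Fin (m + 1) → V =>
    ∃ i, i ≠ 0 ∧ i ≠ Fin.last m ∧ f i = (p (f 0) (f (Fin.last m))).1
  let A₃ := univ.filter fun f : Fin (m + 1) → V =>
    ∃ i, i ≠ 0 ∧ i ≠ Fin.last m ∧ f i = (p (f 0) (f (Fin.last m))).2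
  let A₄ := univ.filter fun f : Fin (m + 1) → V => (f 0, f (Fin.last m)) ∈ B
  have h0 : (0 : Fin (m + 1)) ≠ Fin.last m := by
    intro h
    have := congrArg Fin.val h
    simp at this
    omega
  have h₁ : #A₁ ≤ (m + 1) * (m + 1) * Fintype.card V ^ m := card_filter_not_injective_le _
  have h₂ : #A₂ ≤ (m + 1) * Fintype.card V ^ m :=
    card_filter_exists_eq_le 0 (Fin.last m) fun x y => (p x y).1
  have h₃ : #A₃ ≤ (m + 1) * Fintype.card V ^ m :=
    card_filter_exists_eq_le 0 (Fin.last m) fun x y => (p x y).2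
  have h₄ : #A₄ ≤ #B * Fintype.card V ^ (m - 1) := card_filter_pair_mem_le h0 B
  have hgood : #(pathMaps G W (m + 1) \ (A₁ ∪ A₂ ∪ A₃ ∪ A₄)) ≤ #(cycleMaps G (m + 3)) := by
    have hext : ∀ f : Fin (m + 1) → V, ∃ q : V × V,
        f ∈ pathMaps G W (m + 1) \ (A₁ ∪ A₂ ∪ A₃ ∪ A₄) →
        (Fin.snoc (Fin.snoc f q.2 : Fin (m + 2) → V) q.1 : Fin (m + 3) → V) ∈
          cycleMaps G (m + 3) := by
      intro f
      by_cases hf : f ∈ pathMaps G W (m + 1) \ (A₁ ∪ A₂ ∪ A₃ ∪ A₄)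
      swap
      · exact ⟨(f 0, f 0), fun h => absurd h hf⟩
      simp only [mem_sdiff, mem_union, not_or, A₁, A₂, A₃, A₄, mem_filter, mem_univ, true_and,
        not_not, not_exists, not_and, hB, sparseEdges, not_le] at hf
      obtain ⟨hpath, ⟨⟨hinj, hu⟩, hv⟩, hb⟩ := hf
      have hpath' := (mem_pathMaps.1 hpath).2
      by_cases hadj : G.Adj (f 0) (f (Fin.last m))
      · obtain ⟨q, hq, hq1, hq2⟩ := exists_mem_middleEdges_of_lt f (hb hadj)
        obtain ⟨-, hq⟩ := mem_filter.1 hq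
        exact ⟨q, fun _ => snoc_snoc_mem_cycleMaps hinj hpath' hq1 hq2 hq.1 hq.2.1 hq.2.2⟩
      · obtain ⟨k1, k2, k3, k4, k5⟩ := hp _ _ (hinj.ne h0) hadj
        refine ⟨p (f 0) (f (Fin.last m)), fun _ =>
          snoc_snoc_mem_cycleMaps hinj hpath' ?_ ?_ k1 k2 k3⟩
        · intro i
          by_cases hi0 : i = 0
          · rw [hi0]; exact k1.ne
          by_cases hil : i = Fin.last m
          · rw [hil]; exact k4.symm
          exact hu i hi0 hil
        · intro i
          by_cases hi0 : i = 0
          · rw [hi0]; exact k5.symm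
          by_cases hil : i = Fin.last m
          · rw [hil]; exact k3.ne'
          exact hv i hi0 hil
    choose q hq using hext
    refine card_le_card_of_injOn
      (fun f => (Fin.snoc (Fin.snoc f (q f).2 : Fin (m + 2) → V) (q f).1 : Fin (m + 3) → V))
      (fun f hf => hq f hf) ?_
    intro f _ g _ hfg
    have := congrArg (fun h => Fin.init (Fin.init h)) hfg
    simpa using this
  have htot : #(pathMaps G W (m + 1)) ≤
      #(pathMaps G W (m + 1) \ (A₁ ∪ A₂ ∪ A₃ ∪ A₄)) + #(A₁ ∪ A₂ ∪ A₃ ∪ A₄) := by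
    have := le_card_sdiff (A₁ ∪ A₂ ∪ A₃ ∪ A₄) (pathMaps G W (m + 1))
    omega
  have hun : #(A₁ ∪ A₂ ∪ A₃ ∪ A₄) ≤ #A₁ + #A₂ + #A₃ + #A₄ := by
    refine (card_union_le _ _).trans (Nat.add_le_add_right ?_ _)
    refine (card_union_le _ _).trans (Nat.add_le_add_right ?_ _)
    exact card_union_le _ _
  linarith

lemma sum_degree_pow_four_le :
    (∑ x, #(univ.filter (G.Adj x))) ^ 4 ≤
      Fintype.card V ^ 4 * (#(cycleMaps G 4) + 16 * Fintype.card V ^ 3) := by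
  let a : V → V → ℕ := fun x y => if G.Adj x y then 1 else 0
  have h := sum_pow_four_le a fun x y => by simp only [a, G.adj_comm]
  simp only [card_filter]
  refine h.trans (Nat.mul_le_mul_left _ ?_)
  let S := univ.filter fun f : Fin 4 → V =>
    G.Adj (f 0) (f 1) ∧ G.Adj (f 1) (f 2) ∧ G.Adj (f 2) (f 3) ∧ G.Adj (f 3) (f 0)
  have hS : ∑ x, ∑ y, a x y * ∑ u, ∑ v, a x u * a u v * a v y ≤ #S := by
    let T : Finset (V × V × V × V) := univ.filter fun p => G.Adj p.1 p.2.1 ∧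
      G.Adj p.1 p.2.2.1 ∧ G.Adj p.2.2.1 p.2.2.2 ∧ G.Adj p.2.2.2 p.2.1
    have hT : ∑ x, ∑ y, a x y * ∑ u, ∑ v, a x u * a u v * a v y = #T := by
      simp only [T, card_filter, Fintype.sum_prod_type, mul_sum]
      refine sum_congr rfl fun x _ => sum_congr rfl fun y _ => sum_congr rfl fun u _ =>
        sum_congr rfl fun v _ => ?_
      simp only [a, ite_and, mul_ite, mul_one, mul_zero]
      split_ifs <;> rfl
    rw [hT]
    refine card_le_card_of_injOn (fun p => ![p.1, p.2.2.1, p.2.2.2, p.2.1]) ?_ ?_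
    · intro p hp
      have := (mem_filter.1 hp).2
      simp only [S, coe_filter, mem_univ, true_and, Set.mem_ofPred_eq, Matrix.cons_val]
      exact ⟨this.2.1, this.2.2.1, this.2.2.2, this.1.symm⟩
    · rintro ⟨x, y, u, v⟩ _ ⟨x', y', u', v'⟩ _ h
      have h0 := congrFun h 0
      have h1 := congrFun h 1
      have h2 := congrFun h 2
      have h3 := congrFun h 3
      simp at h0 h1 h2 h3
      simp [h0, h1, h2, h3]
  have hsub : S ⊆ cycleMaps G 4 ∪ univ.filter fun f : Fin 4 → V => ¬ Function.Injective f := by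
    intro f hf
    obtain ⟨-, h1, h2, h3, h4⟩ := mem_filter.1 hf
    by_cases hinj : Function.Injective f
    · refine mem_union_left _ (mem_cycleMaps_of_forall_add_one (r := 2) hinj ?_)
      intro i
      fin_cases i
      exacts [h1, h2, h3, h4]
    · exact mem_union_right _ (by simpa using hinj)
  refine hS.trans ((card_le_card hsub).trans ((card_union_le _ _).trans ?_))
  exact Nat.add_le_add_left (card_filter_not_injective_le 4) _

end Counting

lemma exists_mul_pow_le_card_cycleMaps_add_three {s m : ℕ} (hs : 4 ≤ s) (hm : 1 ≤ m) {η : ℝ}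
    (hη : 0 < η) :
    ∃ c : ℝ, 0 < c ∧ ∃ n₀ : ℕ, ∀ n ≥ n₀, ∀ (G : SimpleGraph (Fin n)) [DecidableRel G.Adj],
      KSat s G → η * n ^ 2 ≤ ∑ x, #(univ.filter (G.Adj x)) →
      c * n ^ (m + 1) ≤ #(cycleMaps G (m + 3)) := by
  set c₀ : ℝ := (η / 8) ^ (m + 1) with hc₀
  have hc₀pos : 0 < c₀ := by positivity
  set K : ℕ := (m + 1) * (m + 1) + 2 * (m + 1) with hK
  obtain ⟨n₁, hn₁⟩ := exists_nat_ge (8 / η)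
  obtain ⟨n₂, hn₂⟩ := exists_nat_ge (4 * K / c₀)
  obtain ⟨n₃, hn₃⟩ := exists_nat_ge (2 * (m + 1) / (c₀ / 4) ^ 3)
  refine ⟨c₀ / 2, by positivity, max 1 (max n₁ (max n₂ n₃)), ?_⟩
  intro n hn G _ hG hsum
  simp only [ge_iff_le, max_le_iff] at hn
  obtain ⟨hn0, h1, h2, h3⟩ := hn
  have hnpos : (0 : ℝ) < n := by exact_mod_cast hn0
  have h1 : 8 / η ≤ n := hn₁.trans (by exact_mod_cast h1)
  have h2 : 4 * K / c₀ ≤ n := hn₂.trans (by exact_mod_cast h2)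
  have h3 : 2 * (m + 1) / (c₀ / 4) ^ 3 ≤ n := hn₃.trans (by exact_mod_cast h3)
  rw [div_le_iff₀ (by positivity)] at h1 h2 h3
  set D : ℕ := ⌊η * n / 4⌋₊ with hD
  have hDle : (D : ℝ) ≤ η * n / 4 := Nat.floor_le (by positivity)
  have hDge : η / 8 * n ≤ D := by
    have := Nat.lt_floor_add_one (η * n / 4)
    rw [← hD] at this
    linarith
  have hW : 2 * D * #(univ : Finset (Fin n)) < ∑ x ∈ univ, #(univ.filter (G.Adj x)) := by
    rw [card_univ, Fintype.card_fin, ← Nat.cast_lt (α := ℝ)]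
    refine lt_of_lt_of_le ?_ hsum
    push_cast
    calc (2 * D * n : ℝ) ≤ 2 * (η * n / 4) * n := by gcongr
      _ < η * n ^ 2 := by
        have : 0 < η * n ^ 2 := by positivity
        linarith
  obtain ⟨U, hU, hdeg⟩ := exists_subset_forall_lt_degree G (2 * D) univ hW
  have hpath : c₀ * n ^ (m + 1) ≤ #(pathMaps G U (m + 1)) := by
    have := pow_le_card_pathMaps G hU (D := D) (fun x hx => by have := hdeg x hx; omega) (m + 1)
    calc c₀ * n ^ (m + 1) = (η / 8 * n) ^ (m + 1) := by rw [hc₀, mul_pow]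
      _ ≤ (D : ℝ) ^ (m + 1) := by gcongr
      _ ≤ _ := by exact_mod_cast this
  have hmain := card_pathMaps_le hs hG U hm
  have hB := card_sparseEdges_pow_three_le G (2 * (m + 1) * Fintype.card (Fin n))
  rw [Fintype.card_fin] at hmain hB
  set B := #(sparseEdges G (2 * (m + 1) * n)) with hBdef
  have hB' : (B : ℝ) ≤ c₀ / 4 * n ^ 2 := by
    refine le_of_pow_le_pow_left₀ (n := 3) (by norm_num) (by positivity) ?_
    calc (B : ℝ) ^ 3 ≤ (n : ℝ) ^ 4 * (2 * (m + 1) * n) := by exact_mod_cast hB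
      _ = 2 * (m + 1) * (n : ℝ) ^ 5 := by ring
      _ ≤ n * (c₀ / 4) ^ 3 * n ^ 5 := by gcongr
      _ = _ := by ring
  have hsparse : (B : ℝ) * n ^ (m - 1) ≤ c₀ / 4 * n ^ (m + 1) := by
    calc (B : ℝ) * n ^ (m - 1) ≤ c₀ / 4 * n ^ 2 * n ^ (m - 1) := by gcongr
      _ = _ := by rw [mul_assoc, ← pow_add]; congr 2; omega
  have hK' : (K : ℝ) * n ^ m ≤ c₀ / 4 * n ^ (m + 1) := by
    rw [pow_succ']
    have : 0 ≤ (n : ℝ) ^ m := by positivity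
    nlinarith
  have hmain' : (#(pathMaps G U (m + 1)) : ℝ) ≤
      #(cycleMaps G (m + 3)) + K * n ^ m + B * n ^ (m - 1) := by exact_mod_cast hmain
  linarith

lemma exists_mul_pow_le_card_cycleMaps {s r : ℕ} (hs : 4 ≤ s) (hr : 4 ≤ r) {η : ℝ}
    (hη : 0 < η) :
    ∃ c : ℝ, 0 < c ∧ ∃ n₀ : ℕ, ∀ n ≥ n₀, ∀ (G : SimpleGraph (Fin n)) [DecidableRel G.Adj],
      KSat s G → η * n ^ 2 ≤ ∑ x, #(univ.filter (G.Adj x)) →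
      c * n ^ (r / 2 + 1) ≤ #(cycleMaps G r) := by
  rcases hr.eq_or_lt with rfl | hr
  · obtain ⟨n₁, hn₁⟩ := exists_nat_ge (32 / η ^ 4)
    refine ⟨η ^ 4 / 2, by positivity, max 1 n₁, ?_⟩
    intro n hn G _ _ hsum
    simp only [ge_iff_le, max_le_iff] at hn
    have hn0 : (1 : ℝ) ≤ n := by exact_mod_cast hn.1
    have h1 : 32 / η ^ 4 ≤ n := hn₁.trans (by exact_mod_cast hn.2)
    rw [div_le_iff₀ (by positivity)] at h1
    have h := sum_degree_pow_four_le (G := G)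
    rw [Fintype.card_fin] at h
    have h' : (η * n ^ 2) ^ 4 ≤ (n : ℝ) ^ 4 * (#(cycleMaps G 4) + 16 * n ^ 3) := by
      calc (η * n ^ 2) ^ 4 ≤ ((∑ x, #(univ.filter (G.Adj x)) : ℕ) : ℝ) ^ 4 := by gcongr
        _ ≤ _ := by exact_mod_cast h
    have h'' : η ^ 4 * n ^ 4 ≤ (#(cycleMaps G 4) : ℝ) + 16 * n ^ 3 := by
      refine le_of_mul_le_mul_left (a := (n : ℝ) ^ 4) ?_ (by positivity)
      calc _ = (η * n ^ 2) ^ 4 := by ring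
        _ ≤ _ := h'
    have h3 : 0 ≤ (n : ℝ) ^ 3 := by positivity
    have h4 : 16 * (n : ℝ) ^ 3 ≤ η ^ 4 / 2 * n ^ 4 := by
      rw [pow_succ' (n : ℝ) 3]
      nlinarith
    calc η ^ 4 / 2 * n ^ (4 / 2 + 1) ≤ η ^ 4 / 2 * (n : ℝ) ^ 4 := by
          gcongr
          norm_num
      _ ≤ _ := by linarith
  · obtain ⟨m, rfl⟩ := Nat.exists_eq_add_of_le' (show 3 ≤ r by omega)
    obtain ⟨c, hc, n₀, h⟩ :=
      exists_mul_pow_le_card_cycleMaps_add_three hs (show 1 ≤ m by omega) hη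
    refine ⟨c, hc, max 1 n₀, ?_⟩
    intro n hn G _ hG hsum
    simp only [ge_iff_le, max_le_iff] at hn
    have hn0 : (1 : ℝ) ≤ n := by exact_mod_cast hn.1
    refine le_trans ?_ (h n hn.2 G hG hsum)
    gcongr
    omega

lemma choose_le_indepCount_one (n : ℕ) (G : SimpleGraph (Fin n)) :
    n.choose 1 ≤ indepCount G 1 := by
  have : #(powersetCard 1 (univ : Finset (Fin n))) = n.choose 1 := by simp
  rw [← this, ← Set.ncard_coe_finset]
  refine Set.ncard_le_ncard ?_ (Set.toFinite _)
  intro t ht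
  have ht' : #t = 1 := (mem_powersetCard.1 ht).2
  refine ⟨ht', fun a ha b hb => ?_⟩
  rw [card_le_one.1 ht'.le a ha b hb]
  exact G.irrefl

lemma choose_le_indepCount_add {n k : ℕ} (G : SimpleGraph (Fin n)) [DecidableRel G.Adj] :
    n.choose (k + 2) ≤
      indepCount G (k + 2) + (∑ x, #(univ.filter (G.Adj x))) * (n - 2).choose k := by
  let P := powersetCard (k + 2) (univ : Finset (Fin n))
  let E : Finset (Fin n × Fin n) := univ.filter fun p => G.Adj p.1 p.2
  let Q : Fin n × Fin n → Finset (Finset (Fin n)) := fun p =>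
    P.filter fun t => p.1 ∈ t ∧ p.2 ∈ t
  have hP : #P = n.choose (k + 2) := by simp [P]
  have hE : #E = ∑ x, #(univ.filter (G.Adj x)) := by
    simp only [E, card_filter, Fintype.sum_prod_type]
  have hsplit := card_filter_add_card_filter_not (s := P)
    (fun t => ∀ a ∈ t, ∀ b ∈ t, ¬ G.Adj a b)
  have hind : #(P.filter fun t => ∀ a ∈ t, ∀ b ∈ t, ¬ G.Adj a b) ≤ indepCount G (k + 2) := by
    rw [← Set.ncard_coe_finset]
    refine Set.ncard_le_ncard ?_ (Set.toFinite _)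
    intro t ht
    obtain ⟨ht, ht'⟩ := mem_filter.1 ht
    exact ⟨(mem_powersetCard.1 ht).2, ht'⟩
  have hsub : (P.filter fun t => ¬ ∀ a ∈ t, ∀ b ∈ t, ¬ G.Adj a b) ⊆ E.biUnion Q := by
    intro t ht
    obtain ⟨ht, ht'⟩ := mem_filter.1 ht
    push Not at ht'
    obtain ⟨a, ha, b, hb, hab⟩ := ht'
    exact mem_biUnion.2 ⟨(a, b), mem_filter.2 ⟨mem_univ _, hab⟩, mem_filter.2 ⟨ht, ha, hb⟩⟩
  have hQ : ∀ p ∈ E, #(Q p) ≤ (n - 2).choose k := by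
    intro p hp
    have hne : p.1 ≠ p.2 := (mem_filter.1 hp).2.ne
    have hcard : #({p.1, p.2} : Finset (Fin n)) = 2 := card_pair hne
    calc #(Q p) ≤ #(powersetCard k (univ \ {p.1, p.2})) := by
          have hpt : ∀ t ∈ Q p, ({p.1, p.2} : Finset (Fin n)) ⊆ t := by
            intro t ht
            have := (mem_filter.1 ht).2
            simp [insert_subset_iff, this]
          refine card_le_card_of_injOn (fun t => t \ {p.1, p.2}) ?_ ?_
          · intro t ht
            have htk : #t = k + 2 := (mem_powersetCard.1 (mem_filter.1 ht).1).2
            refine mem_coe.2 (mem_powersetCard.2 ⟨sdiff_subset_sdiff (subset_univ _) le_rfl, ?_⟩)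
            rw [card_sdiff_of_subset (hpt t ht), hcard, htk]
            rfl
          · intro t ht u hu htu
            rw [← sdiff_union_of_subset (hpt t ht), ← sdiff_union_of_subset (hpt u hu)]
            exact congrArg (· ∪ _) htu
      _ = _ := by
          rw [card_powersetCard, card_sdiff_of_subset (subset_univ _), hcard, card_univ,
            Fintype.card_fin]
  have hbad := (card_le_card hsub).trans (card_biUnion_le_card_mul _ _ _ hQ)
  rw [hE] at hbad
  omega

lemma choose_sub_two_mul {n k : ℕ} (hn : 2 ≤ n) :
    n * (n - 1) * (n - 2).choose k = n.choose (k + 2) * ((k + 2) * (k + 1)) := by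
  obtain ⟨m, rfl⟩ := Nat.exists_eq_add_of_le' hn
  have h1 := Nat.add_one_mul_choose_eq m k
  have h2 := Nat.add_one_mul_choose_eq (m + 1) (k + 1)
  simp only [Nat.add_sub_cancel, show m + 2 - 1 = m + 1 from rfl]
  calc (m + 2) * (m + 1) * m.choose k = (m + 2) * ((m + 1) * m.choose k) := by ring
    _ = ((m + 1 + 1) * (m + 1).choose (k + 1)) * (k + 1) := by rw [h1]; ring
    _ = _ := by rw [h2]; ring

/-- Let `s ≥ 4`, `3 ≤ r ≤ 2s - 4` and `k = ⌊r/2⌋`. For every `ε > 0` there is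
`n₀` such that for all `n ≥ n₀`, every `n`-vertex `K_s`-saturated graph minimizing the number
of copies of `C_r` has at least `(1 - ε)·C(n,k)` independent sets of size `k`. -/
theorem indep_count_of_min (s r : ℕ) (hs : 4 ≤ s) (hr3 : 3 ≤ r) (hr : r ≤ 2 * s - 4)
    (ε : ℝ) (hε : 0 < ε) :
    ∃ n₀ : ℕ, ∀ n ≥ n₀, ∀ G : SimpleGraph (Fin n), KSat s G →
      (∀ G' : SimpleGraph (Fin n), KSat s G' → cycleCount G r ≤ cycleCount G' r) →
      (1 - ε) * (n.choose (r / 2) : ℝ) ≤ (indepCount G (r / 2) : ℝ) := by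
  classical
  rcases hr3.eq_or_lt with rfl | hr4
  · refine ⟨0, fun n _ G _ _ => ?_⟩
    have h : ((n.choose 1 : ℕ) : ℝ) ≤ indepCount G 1 := by
      exact_mod_cast choose_le_indepCount_one n G
    have h0 : (0 : ℝ) ≤ n.choose 1 := by positivity
    change (1 - ε) * (n.choose 1 : ℝ) ≤ (indepCount G 1 : ℝ)
    nlinarith
  obtain ⟨k, hk⟩ := Nat.exists_eq_add_of_le' (show 2 ≤ r / 2 by omega)
  obtain ⟨c, hc, n₁, hmany⟩ := exists_mul_pow_le_card_cycleMaps (r := r) hs (by omega)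
    (show 0 < ε / (2 * ((k + 2) * (k + 1))) by positivity)
  set C : ℕ := r ^ r * (2 ^ r * s ^ r) with hC
  obtain ⟨n₂, hn₂⟩ := exists_nat_gt (C / c)
  refine ⟨max 2 (max n₁ n₂), fun n hn G hG hmin => ?_⟩
  simp only [ge_iff_le, max_le_iff] at hn
  obtain ⟨hn0, h1, h2⟩ := hn
  have hn2 : (2 : ℝ) ≤ n := by exact_mod_cast hn0
  have hCn : C / c < n := hn₂.trans_le (by exact_mod_cast h2)
  rw [div_lt_iff₀ hc] at hCn
  have hfew : (∑ x, #(univ.filter (G.Adj x)) : ℕ) <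
      ε / (2 * ((k + 2) * (k + 1))) * (n : ℝ) ^ 2 := by
    by_contra! hcon
    have hlow := hmany n h1 G hG hcon
    have hup : #(cycleMaps G r) ≤ C * n ^ (r / 2) := by
      calc #(cycleMaps G r) ≤ r ^ r * cycleCount G r := card_cycleMaps_le G r
        _ ≤ r ^ r * cycleCount (joinGraph n s) r := by
          gcongr
          exact hmin _ (kSat_joinGraph (by omega))
        _ ≤ r ^ r * (2 ^ r * s ^ r * n ^ (r / 2)) := by
          gcongr
          exact (cycleCount_le_card_cycleMaps _ _).trans
            (card_cycleMaps_joinGraph_le (by omega) (by omega) (by omega))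
        _ = _ := by rw [hC]; ring
    have hup' : (#(cycleMaps G r) : ℝ) ≤ C * n ^ (r / 2) := by exact_mod_cast hup
    have hpos : (0 : ℝ) < n ^ (r / 2) := by positivity
    rw [pow_succ'] at hlow
    nlinarith
  rw [hk]
  have hchoose := choose_sub_two_mul (n := n) (k := k) hn0
  have hchoose' : (n : ℝ) * (n - 1) * (n - 2).choose k =
      n.choose (k + 2) * ((k + 2) * (k + 1)) := by
    have : ((n - 1 : ℕ) : ℝ) = n - 1 := by rw [Nat.cast_sub (by omega)]; simp
    rw [← this]
    exact_mod_cast hchoose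
  have hind : (n.choose (k + 2) : ℝ) ≤ indepCount G (k + 2) +
      (∑ x, #(univ.filter (G.Adj x)) : ℕ) * (n - 2).choose k := by
    exact_mod_cast choose_le_indepCount_add G
  have hbad : ((∑ x, #(univ.filter (G.Adj x)) : ℕ) : ℝ) * (n - 2).choose k ≤
      ε * n.choose (k + 2) := by
    calc _ ≤ ε / (2 * ((k + 2) * (k + 1))) * (n : ℝ) ^ 2 * (n - 2).choose k := by gcongr
      _ ≤ ε / (2 * ((k + 2) * (k + 1))) * (2 * (n * (n - 1))) * (n - 2).choose k := by
        gcongr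
        nlinarith
      _ = ε / ((k + 2) * (k + 1)) * (n * (n - 1) * (n - 2).choose k) := by
        field_simp
      _ = _ := by
        rw [hchoose']
        field_simp
  linarith
end

section
/- For every integer m ≥ 4, let ℱ_m = {B_{m,m}, V_m, Λ_m}, where B_{m,m} is the disjoint union of two copies of K_m plus one edge joining them, V_m is a copy of K_m plus two additional edges incident to a single vertex of the K_m (with two new endpoints), and Λ_m is a copy of K_m plus a single new vertex with exactly two edges to the K_m. Then the sequence sat(n, ℱ_m)/n does not converge as n → ∞. -/
open SimpleGraph Finset

variable {V : Type*}

section CliqueConfigurations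

variable (m : ℕ) (G : SimpleGraph V)

/-- Two disjoint `m`-cliques joined by an edge. -/
def HasJoinedCliques : Prop :=
  ∃ K K' : Finset V, G.IsNClique m K ∧ G.IsNClique m K' ∧ Disjoint K K' ∧
    ∃ a ∈ K, ∃ b ∈ K', G.Adj a b

/-- An `m`-clique with a vertex having two neighbours outside the clique. -/
def HasCliqueWithCherry : Prop :=
  ∃ K : Finset V, G.IsNClique m K ∧ ∃ a ∈ K, ∃ x ∉ K, ∃ y ∉ K, x ≠ y ∧ G.Adj a x ∧ G.Adj a y

/-- An `m`-clique with an outside vertex having two neighbours in the clique. -/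
def HasCliqueWithHat : Prop :=
  ∃ K : Finset V, G.IsNClique m K ∧ ∃ x ∉ K, ∃ a ∈ K, ∃ b ∈ K, a ≠ b ∧ G.Adj a x ∧ G.Adj b x

/-- One of the three forbidden configurations occurs. -/
def HasForbidden : Prop :=
  HasJoinedCliques m G ∨ HasCliqueWithCherry m G ∨ HasCliqueWithHat m G

end CliqueConfigurations

section Copies

variable {m : ℕ} {G : SimpleGraph V}

lemma exists_enum_of_card_eq {K : Finset V} (hK : #K = m) {a b : V} (ha : a ∈ K) (hb : b ∈ K)
    (hab : a ≠ b) :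
    ∃ g : ℕ → V, (∀ i < m, ∀ j < m, g i = g j → i = j) ∧ (∀ i < m, g i ∈ K) ∧
      g 0 = a ∧ g 1 = b := by
  classical
  set l : List V := a :: b :: ((K.erase a).erase b).toList with hl
  have hb' : b ∈ K.erase a := by simp [hb, hab.symm]
  have hlen : l.length = m := by
    have h1 := Finset.card_erase_add_one ha
    have h2 := Finset.card_erase_add_one hb'
    simp only [hl, List.length_cons, Finset.length_toList]
    omega
  have hnd : l.Nodup := by
    simp [hl, hab, Finset.nodup_toList]
  have hmem : ∀ x ∈ l, x ∈ K := by
    intro x hx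
    simp only [hl, List.mem_cons, Finset.mem_toList, Finset.mem_erase] at hx
    rcases hx with rfl | rfl | hx
    exacts [ha, hb, hx.2.2]
  refine ⟨fun i => if h : i < l.length then l[i] else a, ?_, ?_, ?_, ?_⟩
  · intro i hi j hj h
    rw [← hlen] at hi hj
    simp only [hi, hj, dif_pos] at h
    exact (hnd.getElem_inj_iff).1 h
  · intro i hi
    rw [← hlen] at hi
    simp only [hi, dif_pos]
    exact hmem _ (List.getElem_mem hi)
  · simp [hl]
  · simp [hl]

lemma containsCopy_fromRel {α : Type*} {r : α → α → Prop} (f : α → V)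
    (hf : Function.Injective f) (h : ∀ i j, i ≠ j → r i j → G.Adj (f i) (f j)) :
    ContainsCopy (SimpleGraph.fromRel r) G := by
  refine ⟨f, hf, fun i j hij => ?_⟩
  rw [SimpleGraph.fromRel_adj] at hij
  rcases hij with ⟨hne, hr | hr⟩
  · exact h i j hne hr
  · exact (h j i hne.symm hr).symm

lemma isNClique_image_univ [DecidableEq V] (g : Fin m → V)
    (hg : ∀ i j, i ≠ j → G.Adj (g i) (g j)) :
    G.IsNClique m (Finset.univ.image g) := by
  have hinj : Function.Injective g := by
    intro i j hij
    by_contra hne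
    exact (hg i j hne).ne hij
  refine ⟨?_, ?_⟩
  · intro x hx y hy hxy
    simp only [Finset.coe_image, Finset.coe_univ, Set.image_univ, Set.mem_range] at hx hy
    obtain ⟨i, rfl⟩ := hx
    obtain ⟨j, rfl⟩ := hy
    exact hg i j (fun h => hxy (by rw [h]))
  · rw [Finset.card_image_of_injective _ hinj]
    simp

lemma SimpleGraph.IsNClique.adj_of_mem {K : Finset V} (hK : G.IsNClique m K) {a b : V}
    (ha : a ∈ K) (hb : b ∈ K) (hab : a ≠ b) : G.Adj a b :=
  hK.1 ha hb hab

lemma SimpleGraph.IsNClique.exists_mem_ne {K : Finset V} (hK : G.IsNClique m K) (hm : 2 ≤ m)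
    (a : V) : ∃ b ∈ K, b ≠ a :=
  Finset.exists_mem_ne (by rw [hK.2]; omega) a

lemma containsCopy_dumbbell_iff (hm : 2 ≤ m) :
    ContainsCopy (dumbbell m) G ↔ HasJoinedCliques m G := by
  classical
  constructor
  · rintro ⟨f, hf, h⟩
    refine ⟨univ.image fun i : Fin m => f ⟨i, by omega⟩,
      univ.image fun i : Fin m => f ⟨m + i, by omega⟩,
      isNClique_image_univ _ ?_, isNClique_image_univ _ ?_, ?_,
      f ⟨0, by omega⟩, ?_, f ⟨m, by omega⟩, ?_, ?_⟩
    · intro i j hij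
      apply h
      simp only [dumbbell, SimpleGraph.fromRel_adj, ne_eq, Fin.mk.injEq]
      omega
    · intro i j hij
      apply h
      simp only [dumbbell, SimpleGraph.fromRel_adj, ne_eq, Fin.mk.injEq]
      omega
    · rw [Finset.disjoint_left]
      intro x hx hy
      simp only [mem_image, mem_univ, true_and] at hx hy
      obtain ⟨i, rfl⟩ := hx
      obtain ⟨j, hj⟩ := hy
      have := hf hj
      simp only [Fin.mk.injEq] at this
      omega
    · exact mem_image.2 ⟨⟨0, by omega⟩, mem_univ _, rfl⟩
    · exact mem_image.2 ⟨⟨0, by omega⟩, mem_univ _, rfl⟩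
    · apply h
      simp only [dumbbell, SimpleGraph.fromRel_adj, ne_eq, Fin.mk.injEq, and_true,
        true_or, or_true]
      omega
  · rintro ⟨K, K', hK, hK', hd, a, ha, b, hb, hab⟩
    obtain ⟨a', ha', hne⟩ := hK.exists_mem_ne hm a
    obtain ⟨b', hb', hne'⟩ := hK'.exists_mem_ne hm b
    obtain ⟨g, ginj, gK, g0, -⟩ := exists_enum_of_card_eq hK.2 ha ha' hne.symm
    obtain ⟨g', ginj', gK', g0', -⟩ := exists_enum_of_card_eq hK'.2 hb hb' hne'.symm
    have hdis : ∀ i < m, ∀ j < m, g i ≠ g' j := fun i hi j hj h =>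
      Finset.disjoint_left.1 hd (gK i hi) (h ▸ gK' j hj)
    refine containsCopy_fromRel (fun i => if (i : ℕ) < m then g i else g' (i - m)) ?_ ?_
    · intro i j hij
      ext
      dsimp only at hij
      split_ifs at hij with h1 h2 h2
      · exact ginj _ h1 _ h2 hij
      · exact absurd hij (hdis _ h1 _ (by omega))
      · exact absurd hij.symm (hdis _ h2 _ (by omega))
      · have := ginj' _ (by omega) _ (by omega) hij
        omega
    · intro i j hij hr
      have hij' : (i : ℕ) ≠ j := fun h => hij (Fin.ext h)
      rcases hr with ⟨h1, h2⟩ | ⟨h1, h2⟩ | ⟨h1, h2⟩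
      · simp only [h1, h2, if_true]
        exact hK.adj_of_mem (gK _ h1) (gK _ h2) fun h => hij' (ginj _ h1 _ h2 h)
      · simp only [h1.not_gt, h2.not_gt, if_false]
        refine hK'.adj_of_mem (gK' _ (by omega)) (gK' _ (by omega)) fun h => ?_
        have := ginj' _ (by omega) _ (by omega) h
        omega
      · have hm0 : 0 < m := by omega
        simp only [h1, h2, hm0, if_true, lt_irrefl, if_false, Nat.sub_self, g0, g0']
        exact hab

lemma containsCopy_Vgraph_iff (hm : 2 ≤ m) :
    ContainsCopy (Vgraph m) G ↔ HasCliqueWithCherry m G := by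
  classical
  constructor
  · rintro ⟨f, hf, h⟩
    refine ⟨univ.image fun i : Fin m => f ⟨i, by omega⟩, isNClique_image_univ _ ?_,
      f ⟨0, by omega⟩, ?_, f ⟨m, by omega⟩, ?_, f ⟨m + 1, by omega⟩, ?_, ?_, ?_, ?_⟩
    · intro i j hij
      apply h
      simp only [Vgraph, SimpleGraph.fromRel_adj, ne_eq, Fin.mk.injEq]
      omega
    · exact mem_image.2 ⟨⟨0, by omega⟩, mem_univ _, rfl⟩
    · simp only [mem_image, mem_univ, true_and, hf.eq_iff, Fin.mk.injEq]
      rintro ⟨i, hi⟩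
      omega
    · simp only [mem_image, mem_univ, true_and, hf.eq_iff, Fin.mk.injEq]
      rintro ⟨i, hi⟩
      omega
    · simp [hf.eq_iff]
    all_goals
      apply h
      simp only [Vgraph, SimpleGraph.fromRel_adj, ne_eq, Fin.mk.injEq, true_and]
      omega
  · rintro ⟨K, hK, a, ha, x, hx, y, hy, hxy, hax, hay⟩
    obtain ⟨a', ha', hne⟩ := hK.exists_mem_ne hm a
    obtain ⟨g, ginj, gK, g0, -⟩ := exists_enum_of_card_eq hK.2 ha ha' hne.symm
    have hgx : ∀ i < m, g i ≠ x := fun i hi h => hx (h ▸ gK i hi)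
    have hgy : ∀ i < m, g i ≠ y := fun i hi h => hy (h ▸ gK i hi)
    refine containsCopy_fromRel
      (fun i => if (i : ℕ) < m then g i else if (i : ℕ) = m then x else y) ?_ ?_
    · intro i j hij
      ext
      have := i.2
      have := j.2
      dsimp only at hij
      split_ifs at hij with h1 h2 h3 h4 h5 h6 h7 h8
      · exact ginj _ h1 _ h2 hij
      · exact absurd hij (hgx _ h1)
      · exact absurd hij (hgy _ h1)
      · exact absurd hij.symm (hgx _ (by assumption))
      · omega
      · exact absurd hij hxy
      · exact absurd hij.symm (hgy _ (by assumption))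
      · exact absurd hij.symm hxy
      · omega
    · intro i j hij hr
      have hij' : (i : ℕ) ≠ j := fun h => hij (Fin.ext h)
      rcases hr with ⟨h1, h2⟩ | ⟨h1, h2⟩
      · simp only [h1, h2, if_true]
        exact hK.adj_of_mem (gK _ h1) (gK _ h2) fun h => hij' (ginj _ h1 _ h2 h)
      · have hm0 : 0 < m := by omega
        simp only [h1, h2.not_gt, hm0, if_true, if_false, g0]
        split_ifs
        exacts [hax, hay]

lemma containsCopy_lambdaGraph_iff (hm : 2 ≤ m) :
    ContainsCopy (lambdaGraph m) G ↔ HasCliqueWithHat m G := by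
  classical
  constructor
  · rintro ⟨f, hf, h⟩
    refine ⟨univ.image fun i : Fin m => f ⟨i, by omega⟩, isNClique_image_univ _ ?_,
      f ⟨m, by omega⟩, ?_, f ⟨0, by omega⟩, ?_, f ⟨1, by omega⟩, ?_, ?_, ?_, ?_⟩
    · intro i j hij
      apply h
      simp only [lambdaGraph, SimpleGraph.fromRel_adj, ne_eq, Fin.mk.injEq]
      omega
    · simp only [mem_image, mem_univ, true_and, hf.eq_iff, Fin.mk.injEq]
      rintro ⟨i, hi⟩
      omega
    · exact mem_image.2 ⟨⟨0, by omega⟩, mem_univ _, rfl⟩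
    · exact mem_image.2 ⟨⟨1, by omega⟩, mem_univ _, rfl⟩
    · simp only [ne_eq, hf.eq_iff, Fin.mk.injEq]
      omega
    all_goals
      apply h
      simp only [lambdaGraph, SimpleGraph.fromRel_adj, ne_eq, Fin.mk.injEq, true_and]
      omega
  · rintro ⟨K, hK, x, hx, a, ha, b, hb, hab, hax, hbx⟩
    obtain ⟨g, ginj, gK, g0, g1⟩ := exists_enum_of_card_eq hK.2 ha hb hab
    have hgx : ∀ i < m, g i ≠ x := fun i hi h => hx (h ▸ gK i hi)
    refine containsCopy_fromRel (fun i => if (i : ℕ) < m then g i else x) ?_ ?_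
    · intro i j hij
      ext
      dsimp only at hij
      split_ifs at hij with h1 h2 h2
      · exact ginj _ h1 _ h2 hij
      · exact absurd hij (hgx _ h1)
      · exact absurd hij.symm (hgx _ h2)
      · omega
    · intro i j hij hr
      have hij' : (i : ℕ) ≠ j := fun h => hij (Fin.ext h)
      rcases hr with ⟨h1, h2⟩ | ⟨h1, h2⟩
      · simp only [h1, h2, if_true]
        exact hK.adj_of_mem (gK _ h1) (gK _ h2) fun h => hij' (ginj _ h1 _ h2 h)
      · have hjm : (j : ℕ) < m := by omega
        simp only [h1, lt_irrefl, hjm, if_true, if_false]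
        obtain h | h : (j : ℕ) = 0 ∨ (j : ℕ) = 1 := by omega
        · rw [h, g0]; exact hax.symm
        · rw [h, g1]; exact hbx.symm

lemma famSat3_iff (hm : 2 ≤ m) :
    FamSat3 (dumbbell m) (Vgraph m) (lambdaGraph m) G ↔
      ¬ HasForbidden m G ∧
        ∀ u v : V, u ≠ v → ¬ G.Adj u v → HasForbidden m (addEdge G u v) := by
  simp only [FamSat3, containsCopy_dumbbell_iff hm, containsCopy_Vgraph_iff hm,
    containsCopy_lambdaGraph_iff hm, HasForbidden, not_or, and_assoc]

end Copies

section Structure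

variable {m : ℕ} {G : SimpleGraph V}

lemma addEdge_adj {u v a b : V} :
    (addEdge G u v).Adj a b ↔ G.Adj a b ∨ (((a = u ∧ b = v) ∨ (a = v ∧ b = u)) ∧ a ≠ b) := by
  simp [addEdge, SimpleGraph.sup_adj, SimpleGraph.fromEdgeSet_adj]

lemma le_addEdge (u v : V) : G ≤ addEdge G u v := le_sup_left

/-- A clique of `addEdge G u v` that is not a clique of `G` contains both `u` and `v`. -/
lemma mem_of_isNClique_addEdge {u v : V} {Q : Finset V} (hQ : (addEdge G u v).IsNClique m Q)
    (hQ' : ¬ G.IsNClique m Q) : u ∈ Q ∧ v ∈ Q := by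
  by_contra huv
  refine hQ' ⟨fun a ha b hb hab => ?_, hQ.2⟩
  rcases addEdge_adj.1 (hQ.1 ha hb hab) with h | ⟨⟨rfl, rfl⟩ | ⟨rfl, rfl⟩, -⟩
  · exact h
  · exact absurd ⟨ha, hb⟩ huv
  · exact absurd ⟨hb, ha⟩ huv

lemma adj_of_isNClique_addEdge {u v a b : V} {Q : Finset V}
    (hQ : (addEdge G u v).IsNClique m Q) (ha : a ∈ Q) (hb : b ∈ Q) (hab : a ≠ b) (hau : a ≠ u)
    (hav : a ≠ v) : G.Adj a b := by
  rcases addEdge_adj.1 (hQ.1 ha hb hab) with h | ⟨⟨rfl, rfl⟩ | ⟨rfl, rfl⟩, -⟩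
  · exact h
  · exact absurd rfl hau
  · exact absurd rfl hav

variable (hG : ¬ HasForbidden m G)
include hG

lemma eq_of_adj_of_mem {K : Finset V} (hK : G.IsNClique m K) {x a b : V} (hx : x ∉ K)
    (ha : a ∈ K) (hb : b ∈ K) (hax : G.Adj a x) (hbx : G.Adj b x) : a = b := by
  by_contra hab
  exact hG (.inr (.inr ⟨K, hK, x, hx, a, ha, b, hb, hab, hax, hbx⟩))

lemma eq_of_adj_of_notMem {K : Finset V} (hK : G.IsNClique m K) {a x y : V} (ha : a ∈ K)
    (hx : x ∉ K) (hy : y ∉ K) (hax : G.Adj a x) (hay : G.Adj a y) : x = y := by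
  by_contra hxy
  exact hG (.inr (.inl ⟨K, hK, a, ha, x, hx, y, hy, hxy, hax, hay⟩))

lemma eq_of_mem_of_mem (hm : 3 ≤ m) {K K' : Finset V} (hK : G.IsNClique m K)
    (hK' : G.IsNClique m K') {z : V} (hz : z ∈ K) (hz' : z ∈ K') : K = K' := by
  classical
  by_contra hne
  obtain ⟨x, hx', hx⟩ : ∃ x ∈ K', x ∉ K := by
    by_contra! h
    exact hne (Finset.eq_of_subset_of_card_le h (by rw [hK.2, hK'.2])).symm
  have hzx : z ≠ x := fun h => hx (h ▸ hz)
  obtain ⟨y, hy⟩ : ((K'.erase z).erase x).Nonempty := by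
    rw [← Finset.card_pos, Finset.card_erase_of_mem (by simp [hx', hzx.symm]),
      Finset.card_erase_of_mem hz', hK'.2]
    omega
  simp only [mem_erase] at hy
  obtain ⟨hyx, hyz, hy'⟩ := hy
  by_cases hyK : y ∈ K
  · exact hyz (eq_of_adj_of_mem hG hK hx hyK hz (hK'.adj_of_mem hy' hx' hyx)
      (hK'.adj_of_mem hz' hx' hzx))
  · exact hyx (eq_of_adj_of_notMem hG hK hz hyK hx (hK'.adj_of_mem hz' hy' hyz.symm)
      (hK'.adj_of_mem hz' hx' hzx))

/-- Joining a vertex of an `m`-clique to a vertex in no `m`-clique creates no `m`-clique. -/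
lemma isNClique_of_addEdge (hm : 4 ≤ m) {u v : V} (hu : ∀ K, G.IsNClique m K → u ∉ K)
    {K : Finset V} (hK : G.IsNClique m K) (hv : v ∈ K) {Q : Finset V}
    (hQ : (addEdge G u v).IsNClique m Q) : G.IsNClique m Q := by
  classical
  by_contra hQ'
  obtain ⟨huQ, hvQ⟩ := mem_of_isNClique_addEdge hQ hQ'
  have huK := hu K hK
  have huv : v ≠ u := fun h => huK (h ▸ hv)
  have hcard : 1 < #((Q.erase u).erase v) := by
    rw [Finset.card_erase_of_mem (by simp [huv, hvQ]), Finset.card_erase_of_mem huQ, hQ.2]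
    omega
  obtain ⟨w, hw, w', hw', hww'⟩ := Finset.one_lt_card.1 hcard
  simp only [mem_erase] at hw hw'
  obtain ⟨hwv, hwu, hwQ⟩ := hw
  obtain ⟨hwv', hwu', hwQ'⟩ := hw'
  have awu := adj_of_isNClique_addEdge hQ hwQ huQ hwu hwu hwv
  have awu' := adj_of_isNClique_addEdge hQ hwQ' huQ hwu' hwu' hwv'
  have awv := adj_of_isNClique_addEdge hQ hwQ hvQ hwv hwu hwv
  have awv' := adj_of_isNClique_addEdge hQ hwQ' hvQ hwv' hwu' hwv'
  have aww := adj_of_isNClique_addEdge hQ hwQ hwQ' hww' hwu hwv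
  by_cases h : w ∈ K <;> by_cases h' : w' ∈ K
  · exact hww' (eq_of_adj_of_mem hG hK huK h h' awu awu')
  · exact hwv (eq_of_adj_of_mem hG hK h' h hv aww awv'.symm)
  · exact hwv' (eq_of_adj_of_mem hG hK h h' hv aww.symm awv.symm)
  · exact hww' (eq_of_adj_of_notMem hG hK hv h h' awv.symm awv'.symm)

lemma exists_adj_of_notMem_cliques (hm : 4 ≤ m)
    (hsat : ∀ u v : V, u ≠ v → ¬ G.Adj u v → HasForbidden m (addEdge G u v))
    {u v : V} (hu : ∀ K, G.IsNClique m K → u ∉ K) {K : Finset V} (hK : G.IsNClique m K)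
    (hv : v ∈ K) : (∃ y ∉ K, G.Adj v y) ∨ ∃ b ∈ K, G.Adj b u := by
  have huK := hu K hK
  by_cases huv : G.Adj u v
  · exact .inr ⟨v, hv, huv.symm⟩
  have hne : u ≠ v := fun h => huK (h ▸ hv)
  have hcl : ∀ Q, (addEdge G u v).IsNClique m Q → G.IsNClique m Q :=
    fun Q hQ => isNClique_of_addEdge hG hm hu hK hv hQ
  have hKeq : ∀ Q, G.IsNClique m Q → v ∈ Q → Q = K :=
    fun Q hQ hvQ => eq_of_mem_of_mem hG (by omega) hQ hK hvQ hv
  have hadj : ∀ Q, G.IsNClique m Q → ∀ a ∈ Q, ∀ b, (addEdge G u v).Adj a b →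
      G.Adj a b ∨ (a = v ∧ b = u) := by
    intro Q hQ a ha b hab
    rcases addEdge_adj.1 hab with h | ⟨⟨rfl, rfl⟩ | h, -⟩
    · exact .inl h
    · exact absurd ha (hu Q hQ)
    · exact .inr h
  rcases hsat u v hne huv with ⟨K₁, K₂, h₁, h₂, hd, a, ha, b, hb, hab⟩ |
    ⟨Q, hQ, a, ha, x, hx, y, hy, hxy, hax, hay⟩ | ⟨Q, hQ, x, hx, a, ha, b, hb, hab, hax, hbx⟩
  · exfalso
    have h₁' := hcl _ h₁
    have h₂' := hcl _ h₂
    rcases hadj _ h₁' a ha b hab with h | ⟨rfl, rfl⟩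
    · exact hG (.inl ⟨K₁, K₂, h₁', h₂', hd, a, ha, b, hb, h⟩)
    · exact hu _ h₂' hb
  · left
    have hQ' := hcl _ hQ
    rcases hadj _ hQ' a ha x hax with h | ⟨rfl, rfl⟩ <;>
      rcases hadj _ hQ' a ha y hay with h' | h'
    · exact absurd (eq_of_adj_of_notMem hG hQ' ha hx hy h h') hxy
    · obtain ⟨rfl, rfl⟩ := h'
      exact ⟨x, hKeq Q hQ' ha ▸ hx, h⟩
    · exact ⟨y, hKeq Q hQ' ha ▸ hy, h'⟩
    · exact absurd h'.2.symm hxy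
  · right
    have hQ' := hcl _ hQ
    rcases hadj _ hQ' a ha x hax with h | ⟨rfl, rfl⟩ <;>
      rcases hadj _ hQ' b hb x hbx with h' | h'
    · exact absurd (eq_of_adj_of_mem hG hQ' hx ha hb h h') hab
    · obtain ⟨rfl, rfl⟩ := h'
      exact ⟨a, hKeq Q hQ' hb ▸ ha, h⟩
    · exact ⟨b, hKeq Q hQ' ha ▸ hb, h'⟩
    · exact absurd h'.1.symm hab

/-- Nonadjacent vertices lying in no `m`-clique have `m - 2` common neighbours. -/
lemma exists_common_neighbors
    (hsat : ∀ u v : V, u ≠ v → ¬ G.Adj u v → HasForbidden m (addEdge G u v))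
    {u v : V} (hu : ∀ K, G.IsNClique m K → u ∉ K) (hv : ∀ K, G.IsNClique m K → v ∉ K)
    (hne : u ≠ v) (huv : ¬ G.Adj u v) :
    ∃ W : Finset V, #W = m - 2 ∧ ∀ w ∈ W, G.Adj u w ∧ G.Adj v w := by
  classical
  by_cases hcl : ∀ Q, (addEdge G u v).IsNClique m Q → G.IsNClique m Q
  · exfalso
    have hadj : ∀ Q, G.IsNClique m Q → ∀ a ∈ Q, ∀ b, (addEdge G u v).Adj a b → G.Adj a b := by
      intro Q hQ a ha b hab
      rcases addEdge_adj.1 hab with h | ⟨⟨rfl, rfl⟩ | ⟨rfl, rfl⟩, -⟩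
      · exact h
      · exact absurd ha (hu Q hQ)
      · exact absurd ha (hv Q hQ)
    rcases hsat u v hne huv with ⟨K₁, K₂, h₁, h₂, hd, a, ha, b, hb, hab⟩ |
      ⟨Q, hQ, a, ha, x, hx, y, hy, hxy, hax, hay⟩ | ⟨Q, hQ, x, hx, a, ha, b, hb, hab, hax, hbx⟩
    · exact hG (.inl ⟨K₁, K₂, hcl _ h₁, hcl _ h₂, hd, a, ha, b, hb, hadj _ (hcl _ h₁) a ha b hab⟩)
    · exact hG (.inr (.inl ⟨Q, hcl _ hQ, a, ha, x, hx, y, hy, hxy,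
        hadj _ (hcl _ hQ) a ha x hax, hadj _ (hcl _ hQ) a ha y hay⟩))
    · exact hG (.inr (.inr ⟨Q, hcl _ hQ, x, hx, a, ha, b, hb, hab,
        hadj _ (hcl _ hQ) a ha x hax, hadj _ (hcl _ hQ) b hb x hbx⟩))
  · push Not at hcl
    obtain ⟨Q, hQ, hQ'⟩ := hcl
    obtain ⟨huQ, hvQ⟩ := mem_of_isNClique_addEdge hQ hQ'
    refine ⟨(Q.erase u).erase v, ?_, ?_⟩
    · rw [Finset.card_erase_of_mem (by simp [hne.symm, hvQ]), Finset.card_erase_of_mem huQ, hQ.2]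
      omega
    · intro w hw
      simp only [mem_erase] at hw
      obtain ⟨hwv, hwu, hwQ⟩ := hw
      exact ⟨(adj_of_isNClique_addEdge hQ hwQ huQ hwu hwu hwv).symm,
        (adj_of_isNClique_addEdge hQ hwQ hvQ hwv hwu hwv).symm⟩

end Structure

section Covered

variable {m : ℕ} {G : SimpleGraph V} [Fintype V]

variable (m G) in
open scoped Classical in
/-- The vertices covered by `m`-cliques. -/
noncomputable def coveredVertices : Finset V :=
  univ.filter fun v => ∃ K, G.IsNClique m K ∧ v ∈ K

lemma mem_coveredVertices {v : V} :
    v ∈ coveredVertices m G ↔ ∃ K, G.IsNClique m K ∧ v ∈ K := by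
  simp [coveredVertices]

lemma dvd_card_coveredVertices (hm : 3 ≤ m) (hG : ¬ HasForbidden m G) :
    m ∣ #(coveredVertices m G) := by
  classical
  have h : coveredVertices m G = (univ.filter fun K => G.IsNClique m K).biUnion id := by
    ext v
    simp [mem_coveredVertices]
  rw [h, Finset.card_biUnion]
  · refine Finset.dvd_sum fun K hK => ?_
    rw [mem_filter] at hK
    rw [id, hK.2.2]
  · intro K hK K' hK' hne
    simp only [coe_filter, mem_univ, true_and, Set.mem_ofPred_eq] at hK hK'
    exact Finset.disjoint_left.2 fun z hz hz' => hne (eq_of_mem_of_mem hG hm hK hK' hz hz')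

end Covered

section Counting

variable {m : ℕ} {G : SimpleGraph V} [Fintype V] [DecidableEq V] [DecidableRel G.Adj]

lemma SimpleGraph.IsNClique.le_degree_add_one {K : Finset V} (hK : G.IsNClique m K) {v : V}
    (hv : v ∈ K) : m ≤ G.degree v + 1 := by
  have h : K.erase v ⊆ G.neighborFinset v := fun x hx => by
    rw [mem_erase] at hx
    exact (G.mem_neighborFinset v x).2 (hK.adj_of_mem hv hx.2 hx.1.symm)
  have h1 := Finset.card_le_card h
  have h2 := Finset.card_erase_add_one hv
  rw [G.card_neighborFinset_eq_degree] at h1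
  rw [hK.2] at h2
  omega

lemma SimpleGraph.IsNClique.le_degree_of_adj_notMem {K : Finset V} (hK : G.IsNClique m K)
    {v y : V} (hv : v ∈ K) (hy : y ∉ K) (hvy : G.Adj v y) : m ≤ G.degree v := by
  have h : insert y (K.erase v) ⊆ G.neighborFinset v := fun x hx => by
    rw [mem_insert, mem_erase] at hx
    rw [G.mem_neighborFinset]
    rcases hx with rfl | hx
    · exact hvy
    · exact hK.adj_of_mem hv hx.2 hx.1.symm
  have h1 := Finset.card_le_card h
  have h2 := Finset.card_erase_add_one hv
  rw [Finset.card_insert_of_notMem (by simp [hy]), G.card_neighborFinset_eq_degree] at h1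
  rw [hK.2] at h2
  omega

lemma degree_le_of_mem_isNClique (hG : ¬ HasForbidden m G) {K : Finset V}
    (hK : G.IsNClique m K) {v : V} (hv : v ∈ K) : G.degree v ≤ m := by
  have h1 : #(G.neighborFinset v \ K) ≤ 1 := by
    rw [Finset.card_le_one]
    intro x hx y hy
    simp only [mem_sdiff, G.mem_neighborFinset] at hx hy
    exact eq_of_adj_of_notMem hG hK hv hx.2 hy.2 hx.1 hy.1
  have h2 : G.neighborFinset v ⊆ K.erase v ∪ (G.neighborFinset v \ K) := by
    intro x hx
    simp only [mem_union, mem_erase, mem_sdiff, hx, true_and]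
    rw [G.mem_neighborFinset] at hx
    by_cases hxK : x ∈ K
    · exact .inl ⟨hx.ne', hxK⟩
    · exact .inr hxK
  have h3 := (Finset.card_le_card h2).trans (Finset.card_union_le _ _)
  have h4 := Finset.card_erase_add_one hv
  rw [G.card_neighborFinset_eq_degree] at h3
  rw [hK.2] at h4
  omega

variable (hG : ¬ HasForbidden m G)
  (hsat : ∀ u v : V, u ≠ v → ¬ G.Adj u v → HasForbidden m (addEdge G u v))
include hG hsat

/-- If some vertex is uncovered, every `m`-clique has a vertex of degree at least `m`. -/
lemma sq_mul_card_coveredVertices_le (hm : 4 ≤ m) {u : V} (hu : u ∉ coveredVertices m G) :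
    m ^ 2 * #(coveredVertices m G) ≤ (m + 1) * ∑ v ∈ coveredVertices m G, G.degree v := by
  set T := coveredVertices m G with hT
  set T' := T.filter fun v => m ≤ G.degree v with hT'
  have hu' : ∀ K, G.IsNClique m K → u ∉ K := fun K hK huK =>
    hu (mem_coveredVertices.2 ⟨K, hK, huK⟩)
  have hcover : T ⊆ T'.biUnion fun t => insert t (G.neighborFinset t) := by
    intro v hv
    obtain ⟨K, hK, hvK⟩ := mem_coveredVertices.1 hv
    have key : ∀ b ∈ K, ∀ y ∉ K, G.Adj b y →
        v ∈ T'.biUnion fun t => insert t (G.neighborFinset t) := by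
      intro b hb y hy hby
      rw [mem_biUnion]
      refine ⟨b, mem_filter.2 ⟨mem_coveredVertices.2 ⟨K, hK, hb⟩,
        hK.le_degree_of_adj_notMem hb hy hby⟩, ?_⟩
      rw [mem_insert, G.mem_neighborFinset]
      by_cases hvb : v = b
      · exact .inl hvb
      · exact .inr (hK.adj_of_mem hb hvK (Ne.symm hvb))
    rcases exists_adj_of_notMem_cliques hG hm hsat hu' hK hvK with ⟨y, hy, hvy⟩ | ⟨b, hb, hbu⟩
    · exact key v hvK y hy hvy
    · exact key b hb u (hu' K hK) hbu
  have hT'card : #T ≤ #T' * (m + 1) := by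
    refine (Finset.card_le_card hcover).trans (Finset.card_biUnion_le_card_mul _ _ _ ?_)
    intro t ht
    obtain ⟨K, hK, htK⟩ := mem_coveredVertices.1 (mem_filter.1 ht).1
    refine (Finset.card_insert_le _ _).trans ?_
    rw [G.card_neighborFinset_eq_degree]
    have := degree_le_of_mem_isNClique hG hK htK
    omega
  have hsum : #T * (m - 1) + #T' ≤ ∑ v ∈ T, G.degree v := by
    rw [hT', Finset.card_filter, ← smul_eq_mul, ← Finset.sum_const, ← Finset.sum_add_distrib]
    refine Finset.sum_le_sum fun v hv => ?_
    obtain ⟨K, hK, hvK⟩ := mem_coveredVertices.1 hv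
    have := hK.le_degree_add_one hvK
    split_ifs <;> omega
  obtain ⟨k, rfl⟩ : ∃ k, m = k + 1 := ⟨m - 1, by omega⟩
  simp only [Nat.add_sub_cancel] at hsum
  nlinarith

/-- If at least `m` vertices are uncovered, every covered vertex has degree at least `m`. -/
lemma le_degree_of_mem_coveredVertices (hm : 4 ≤ m) (hR : m ≤ #(coveredVertices m G)ᶜ) {v : V}
    (hv : v ∈ coveredVertices m G) : m ≤ G.degree v := by
  obtain ⟨K, hK, hvK⟩ := mem_coveredVertices.1 hv
  by_contra hdeg
  have hout : ∀ y ∉ K, ¬ G.Adj v y := fun y hy hvy =>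
    hdeg (hK.le_degree_of_adj_notMem hvK hy hvy)
  have hR' : ∀ u ∈ (coveredVertices m G)ᶜ, ∀ K, G.IsNClique m K → u ∉ K :=
    fun u hu K hK huK => (mem_compl.1 hu) (mem_coveredVertices.2 ⟨K, hK, huK⟩)
  have hex : ∀ u ∈ (coveredVertices m G)ᶜ, ∃ b ∈ K.erase v, G.Adj b u := by
    intro u hu
    rcases exists_adj_of_notMem_cliques hG hm hsat (hR' u hu) hK hvK with
      ⟨y, hy, hvy⟩ | ⟨b, hb, hbu⟩
    · exact absurd hvy (hout y hy)
    · refine ⟨b, mem_erase.2 ⟨?_, hb⟩, hbu⟩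
      rintro rfl
      exact hout u (hR' u hu K hK) hbu
  choose! f hf hfadj using hex
  have hle : #(coveredVertices m G)ᶜ ≤ #(K.erase v) := by
    refine Finset.card_le_card_of_injOn f hf fun x hx y hy hxy => ?_
    have hy' := hfadj y hy
    rw [← hxy] at hy'
    exact eq_of_adj_of_notMem hG hK (mem_of_mem_erase (hf x hx)) (hR' x hx K hK) (hR' y hy K hK)
      (hfadj x hx) hy'
  have := Finset.card_erase_add_one hvK
  rw [hK.2] at this
  omega

/-- If at least `m` vertices are uncovered, the average degree is essentially at least `m`. -/
lemma mul_card_le_sum_degree_add (hm : 4 ≤ m) (hR : m ≤ #(coveredVertices m G)ᶜ) :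
    m * Fintype.card V ≤ ∑ v, G.degree v + 2 * m ^ 2 := by
  set T := coveredVertices m G with hT
  have hTdeg : ∀ v ∈ T, m ≤ G.degree v := fun v hv =>
    le_degree_of_mem_coveredVertices hG hsat hm hR hv
  by_cases hall : ∀ v, m ≤ G.degree v
  · have h := Finset.card_nsmul_le_sum univ (fun v => G.degree v) m fun v _ => hall v
    rw [smul_eq_mul, Finset.card_univ] at h
    linarith [mul_comm m (Fintype.card V), Nat.zero_le (m ^ 2)]
  push Not at hall
  obtain ⟨v, hv⟩ := hall
  have hvT : v ∉ T := fun h => (hTdeg v h).not_gt hv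
  have hnot : ∀ u ∉ T, ∀ K, G.IsNClique m K → u ∉ K :=
    fun u hu K hK huK => hu (mem_coveredVertices.2 ⟨K, hK, huK⟩)
  set S := G.neighborFinset v with hS
  have hScard : #S < m := by rw [hS, G.card_neighborFinset_eq_degree]; exact hv
  set W := Tᶜ \ insert v S with hW
  have hWcard : #Tᶜ ≤ #W + m := by
    have h1 := Finset.le_card_sdiff (insert v S) Tᶜ
    rw [← hW] at h1
    have h2 := Finset.card_insert_le v S
    omega
  have hTScard : #T ≤ #(T \ S) + m := by
    have h1 := Finset.le_card_sdiff S T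
    omega
  have hcommon : ∀ u ∈ W, m - 2 ≤ #(S.filter fun s => G.Adj s u) := by
    intro u hu
    simp only [hW, mem_sdiff, mem_compl, mem_insert, not_or, hS, G.mem_neighborFinset] at hu
    obtain ⟨huT, huv, hadj⟩ := hu
    obtain ⟨C, hC, hC'⟩ := exists_common_neighbors hG hsat (hnot u huT) (hnot v hvT) huv
      (fun h => hadj h.symm)
    rw [← hC]
    refine Finset.card_le_card fun w hw => ?_
    rw [mem_filter, hS, G.mem_neighborFinset]
    exact ⟨(hC' w hw).2, (hC' w hw).1.symm⟩
  have hWdeg : #W * (m - 2) ≤ ∑ u ∈ W, G.degree u := by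
    rw [← smul_eq_mul]
    refine Finset.card_nsmul_le_sum _ _ _ fun u hu => (hcommon u hu).trans ?_
    rw [← G.card_neighborFinset_eq_degree]
    refine Finset.card_le_card fun w hw => ?_
    rw [G.mem_neighborFinset]
    exact (mem_filter.1 hw).2.symm
  have hSdeg : #W * (m - 2) ≤ ∑ s ∈ S, G.degree s := by
    calc #W * (m - 2) ≤ ∑ u ∈ W, #(S.filter fun s => G.Adj s u) := by
          rw [← smul_eq_mul]
          exact Finset.card_nsmul_le_sum _ _ _ hcommon
      _ = ∑ s ∈ S, #(W.filter fun u => G.Adj s u) := by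
          simp only [Finset.card_filter]
          exact Finset.sum_comm
      _ ≤ ∑ s ∈ S, G.degree s := by
          refine Finset.sum_le_sum fun s _ => ?_
          rw [← G.card_neighborFinset_eq_degree]
          refine Finset.card_le_card fun w hw => ?_
          rw [G.mem_neighborFinset]
          exact (mem_filter.1 hw).2
  have hTSdeg : #(T \ S) * m ≤ ∑ u ∈ T \ S, G.degree u := by
    rw [← smul_eq_mul]
    exact Finset.card_nsmul_le_sum _ _ _ fun u hu => hTdeg u (mem_sdiff.1 hu).1
  have htotal : ∑ u ∈ S, G.degree u + (∑ u ∈ T \ S, G.degree u + ∑ u ∈ W, G.degree u) ≤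
      ∑ u, G.degree u := by
    have hd1 : Disjoint (T \ S) W := Finset.disjoint_left.2 fun x hx hx' => by
      simp only [hW, mem_sdiff, mem_compl] at hx hx'
      exact hx'.1 hx.1
    have hd2 : Disjoint S (T \ S ∪ W) := Finset.disjoint_left.2 fun x hx hx' => by
      simp only [hW, mem_union, mem_sdiff, mem_insert, not_or] at hx'
      rcases hx' with h | h
      exacts [h.2 hx, h.2.2 hx]
    rw [← Finset.sum_union hd1, ← Finset.sum_union hd2]
    exact Finset.sum_le_sum_of_subset (Finset.subset_univ _)
  have hcard : #T + #Tᶜ = Fintype.card V := Finset.card_add_card_compl T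
  have hm2 : #W * m ≤ 2 * (#W * (m - 2)) := by
    have : m ≤ 2 * (m - 2) := by omega
    nlinarith [Nat.zero_le #W]
  have h1 := Nat.mul_le_mul_right m hTScard
  have h2 := Nat.mul_le_mul_right m hWcard
  rw [← hcard]
  nlinarith

/-- A saturated graph whose order is not a multiple of `m` has average degree bounded below by
`m ^ 2 / (m + 1)` up to a bounded error. -/
lemma sq_mul_card_le_of_not_dvd (hm : 4 ≤ m) (hn : ¬ m ∣ Fintype.card V) :
    m ^ 2 * Fintype.card V ≤ 2 * (m + 1) * #G.edgeFinset + 2 * m ^ 2 * (m + 1) := by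
  have hcard := Finset.card_add_card_compl (coveredVertices m G)
  have hdeg := G.sum_degrees_eq_twice_card_edges
  by_cases hR : m ≤ #(coveredVertices m G)ᶜ
  · have h := mul_card_le_sum_degree_add hG hsat hm hR
    rw [hdeg] at h
    nlinarith [Nat.zero_le (m * Fintype.card V)]
  · obtain ⟨u, hu⟩ : ((coveredVertices m G)ᶜ).Nonempty := by
      rw [Finset.nonempty_iff_ne_empty]
      intro h0
      rw [h0, Finset.card_empty, add_zero] at hcard
      exact hn (hcard ▸ dvd_card_coveredVertices (by omega) hG)
    have h := sq_mul_card_coveredVertices_le hG hsat hm (mem_compl.1 hu)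
    have h' : ∑ v ∈ coveredVertices m G, G.degree v ≤ ∑ v, G.degree v :=
      Finset.sum_le_sum_of_subset (Finset.subset_univ _)
    rw [hdeg] at h'
    have h'' := Nat.mul_le_mul_left (m + 1) h'
    have h3 : m ^ 2 * #(coveredVertices m G)ᶜ ≤ m ^ 2 * (m + 1) :=
      Nat.mul_le_mul_left _ (by omega)
    rw [← hcard, mul_add]
    nlinarith

end Counting

section Existence

variable {m : ℕ}

lemma not_hasForbidden_bot : ¬ HasForbidden m (⊥ : SimpleGraph V) := by
  rintro (⟨K, K', -, -, -, a, -, b, -, h⟩ | ⟨K, -, a, -, x, -, y, -, -, h, -⟩ |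
    ⟨K, -, x, -, a, -, b, -, -, h, -⟩) <;> exact h

lemma exists_saturated [Finite V] (m : ℕ) : ∃ G : SimpleGraph V, ¬ HasForbidden m G ∧
    ∀ u v : V, u ≠ v → ¬ G.Adj u v → HasForbidden m (addEdge G u v) := by
  obtain ⟨G, hG⟩ := (Set.toFinite {G : SimpleGraph V | ¬ HasForbidden m G}).exists_maximal
    ⟨⊥, not_hasForbidden_bot⟩
  refine ⟨G, hG.prop, fun u v huv hadj => ?_⟩
  by_contra h
  exact hadj (hG.le_of_ge h (le_addEdge u v) (addEdge_adj.2 (.inr ⟨.inl ⟨rfl, rfl⟩, huv⟩)))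

/-- The disjoint union of `q` cliques of order `m`. -/
def cliqueUnion (q m : ℕ) : SimpleGraph (Fin (q * m)) where
  Adj i j := i ≠ j ∧ (finProdFinEquiv.symm i).1 = (finProdFinEquiv.symm j).1
  symm := ⟨fun _ _ h => ⟨h.1.symm, h.2.symm⟩⟩
  loopless := ⟨fun _ h => h.1 rfl⟩

/-- The clique of `cliqueUnion q m` containing the vertex `i`. -/
def cliqueUnionBlock {q m : ℕ} (i : Fin (q * m)) : Finset (Fin (q * m)) :=
  univ.filter fun j => (finProdFinEquiv.symm i).1 = (finProdFinEquiv.symm j).1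

lemma card_cliqueUnionBlock {q m : ℕ} (i : Fin (q * m)) : #(cliqueUnionBlock i) = m := by
  have h : cliqueUnionBlock i =
      univ.image fun k : Fin m => finProdFinEquiv ((finProdFinEquiv.symm i).1, k) := by
    ext j
    simp only [cliqueUnionBlock, mem_filter, mem_univ, true_and, mem_image]
    constructor
    · intro hj
      refine ⟨(finProdFinEquiv.symm j).2, ?_⟩
      rw [hj, Prod.mk.eta, Equiv.apply_symm_apply]
    · rintro ⟨k, rfl⟩
      rw [Equiv.symm_apply_apply]
  rw [h, Finset.card_image_of_injective, Finset.card_univ, Fintype.card_fin]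
  intro a b hab
  exact (Prod.mk.inj (finProdFinEquiv.injective hab)).2

lemma isNClique_cliqueUnionBlock {q m : ℕ} (i : Fin (q * m)) :
    (cliqueUnion q m).IsNClique m (cliqueUnionBlock i) := by
  refine ⟨fun a ha b hb hab => ⟨hab, ?_⟩, card_cliqueUnionBlock i⟩
  simp only [cliqueUnionBlock, coe_filter, mem_univ, true_and, Set.mem_ofPred_eq] at ha hb
  exact ha.symm.trans hb

lemma eq_cliqueUnionBlock {q m : ℕ} {K : Finset (Fin (q * m))}
    (hK : (cliqueUnion q m).IsNClique m K) {a : Fin (q * m)} (ha : a ∈ K) :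
    K = cliqueUnionBlock a := by
  refine Finset.eq_of_subset_of_card_le (fun x hx => ?_) (by rw [card_cliqueUnionBlock, hK.2])
  simp only [cliqueUnionBlock, mem_filter, mem_univ, true_and]
  by_cases hax : a = x
  · rw [hax]
  · exact (hK.adj_of_mem ha hx hax).2

lemma mem_of_cliqueUnion_adj {q m : ℕ} {K : Finset (Fin (q * m))}
    (hK : (cliqueUnion q m).IsNClique m K) {a x : Fin (q * m)} (ha : a ∈ K)
    (hax : (cliqueUnion q m).Adj a x) : x ∈ K := by
  rw [eq_cliqueUnionBlock hK ha]
  simpa [cliqueUnionBlock] using hax.2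

lemma not_hasForbidden_cliqueUnion (q m : ℕ) : ¬ HasForbidden m (cliqueUnion q m) := by
  rintro (⟨K, K', hK, hK', hd, a, ha, b, hb, h⟩ | ⟨K, hK, a, ha, x, hx, y, hy, -, h, -⟩ |
    ⟨K, hK, x, hx, a, ha, b, hb, -, h, -⟩)
  · exact Finset.disjoint_left.1 hd (mem_of_cliqueUnion_adj hK ha h) hb
  · exact hx (mem_of_cliqueUnion_adj hK ha h)
  · exact hx (mem_of_cliqueUnion_adj hK ha h)

lemma hasForbidden_addEdge_cliqueUnion {q m : ℕ} (u v : Fin (q * m)) (huv : u ≠ v)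
    (hadj : ¬ (cliqueUnion q m).Adj u v) : HasForbidden m (addEdge (cliqueUnion q m) u v) := by
  refine .inl ⟨cliqueUnionBlock u, cliqueUnionBlock v,
    (isNClique_cliqueUnionBlock u).mono (le_addEdge u v),
    (isNClique_cliqueUnionBlock v).mono (le_addEdge u v), ?_, u, by simp [cliqueUnionBlock], v,
    by simp [cliqueUnionBlock], addEdge_adj.2 (.inr ⟨.inl ⟨rfl, rfl⟩, huv⟩)⟩
  refine Finset.disjoint_left.2 fun x hx hx' => hadj ⟨huv, ?_⟩
  simp only [cliqueUnionBlock, mem_filter, mem_univ, true_and] at hx hx'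
  exact hx.trans hx'.symm

lemma two_mul_ncard_edgeSet_cliqueUnion (q m : ℕ) :
    2 * (cliqueUnion q m).edgeSet.ncard = q * m * (m - 1) := by
  classical
  rw [Set.ncard_eq_toFinset_card', ← SimpleGraph.edgeFinset,
    ← SimpleGraph.sum_degrees_eq_twice_card_edges]
  have h : ∀ i, (cliqueUnion q m).degree i = m - 1 := by
    intro i
    have h1 : (cliqueUnion q m).neighborFinset i = (cliqueUnionBlock i).erase i := by
      ext j
      rw [SimpleGraph.mem_neighborFinset]
      simp [cliqueUnionBlock, cliqueUnion, eq_comm]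
    rw [← SimpleGraph.card_neighborFinset_eq_degree, h1,
      Finset.card_erase_of_mem (by simp [cliqueUnionBlock]), card_cliqueUnionBlock]
  simp [h]

lemma two_mul_satFam3_le (hm : 2 ≤ m) (q : ℕ) :
    2 * satFam3 (q * m) (dumbbell m) (Vgraph m) (lambdaGraph m) ≤ q * m * (m - 1) := by
  rw [← two_mul_ncard_edgeSet_cliqueUnion]
  refine Nat.mul_le_mul_left 2 (Nat.sInf_le ⟨cliqueUnion q m, ?_, rfl⟩)
  exact (famSat3_iff hm).2
    ⟨not_hasForbidden_cliqueUnion q m, fun u v => hasForbidden_addEdge_cliqueUnion u v⟩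

lemma sq_mul_le_satFam3 (hm : 4 ≤ m) {n : ℕ} (hn : ¬ m ∣ n) :
    m ^ 2 * n ≤ 2 * (m + 1) * satFam3 n (dumbbell m) (Vgraph m) (lambdaGraph m) +
      2 * m ^ 2 * (m + 1) := by
  classical
  have hne : {k | ∃ G : SimpleGraph (Fin n),
      FamSat3 (dumbbell m) (Vgraph m) (lambdaGraph m) G ∧ G.edgeSet.ncard = k}.Nonempty := by
    obtain ⟨G, hG⟩ := exists_saturated (V := Fin n) m
    exact ⟨_, G, (famSat3_iff (by omega)).2 hG, rfl⟩
  obtain ⟨G, hG, hcard⟩ := Nat.sInf_mem hne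
  obtain ⟨hG1, hG2⟩ := (famSat3_iff (by omega)).1 hG
  have h := sq_mul_card_le_of_not_dvd hG1 hG2 hm (by rwa [Fintype.card_fin])
  rw [Fintype.card_fin] at h
  rw [satFam3, ← hcard, Set.ncard_eq_toFinset_card', ← SimpleGraph.edgeFinset]
  exact h

end Existence

/-- For every `m ≥ 4`, with `ℱ_m = {B_{m,m}, V_m, Λ_m}`, the sequence
`sat(n, ℱ_m)/n` does not converge as `n → ∞`. -/
theorem satFam3_not_converge (m : ℕ) (hm : 4 ≤ m) :
    ¬ ∃ L : ℝ, Filter.Tendsto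
      (fun n : ℕ => (satFam3 n (dumbbell m) (Vgraph m) (lambdaGraph m) : ℝ) / (n : ℝ))
      Filter.atTop (nhds L) := by
  rintro ⟨L, hL⟩
  have hmR : (4 : ℝ) ≤ m := by exact_mod_cast hm
  have hmul : Filter.Tendsto (fun q : ℕ => (q + 1) * m) Filter.atTop Filter.atTop :=
    Filter.tendsto_atTop_mono (fun q => by simp only [id]; nlinarith) Filter.tendsto_id
  have hupper : L ≤ ((m : ℝ) - 1) / 2 := by
    refine le_of_tendsto' (hL.comp hmul) fun q => ?_
    have h := two_mul_satFam3_le (m := m) (by omega) (q + 1)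
    have hpos : (0 : ℝ) < ((q + 1) * m : ℕ) := by
      exact_mod_cast Nat.mul_pos q.succ_pos (by omega)
    have h' : (2 : ℝ) * satFam3 ((q + 1) * m) (dumbbell m) (Vgraph m) (lambdaGraph m) ≤
        ((q + 1) * m : ℕ) * (m - 1) := by
      have := (Nat.cast_le (α := ℝ)).2 h
      rw [Nat.cast_mul, Nat.cast_mul _ (m - 1), Nat.cast_sub (by omega)] at this
      exact_mod_cast this
    rw [Function.comp_apply, div_le_iff₀ hpos]
    linarith
  have hsucc : Filter.Tendsto (fun q : ℕ => (q + 1) * m + 1) Filter.atTop Filter.atTop :=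
    (Filter.tendsto_add_atTop_nat 1).comp hmul
  have hlower : (m : ℝ) ^ 2 / (2 * (m + 1)) ≤ L := by
    have hlim := (hL.comp hsucc).add
      ((tendsto_const_div_atTop_nhds_zero_nat ((m : ℝ) ^ 2)).comp hsucc)
    rw [add_zero] at hlim
    refine ge_of_tendsto' hlim fun q => ?_
    have hnd : ¬ m ∣ (q + 1) * m + 1 := by
      rw [Nat.dvd_add_right (Dvd.intro_left _ rfl), Nat.dvd_one]
      omega
    have h := (Nat.cast_le (α := ℝ)).2 (sq_mul_le_satFam3 hm hnd)
    simp only [Function.comp_apply]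
    generalize (q + 1) * m + 1 = n at h hnd
    have hn : (0 : ℝ) < n := by
      rcases Nat.eq_zero_or_pos n with rfl | h0
      · exact absurd (dvd_zero m) hnd
      · exact_mod_cast h0
    rw [← add_div, div_le_div_iff₀ (by positivity) hn]
    push_cast at h
    linarith
  have hlt : ((m : ℝ) - 1) / 2 < (m : ℝ) ^ 2 / (2 * (m + 1)) := by
    rw [div_lt_div_iff₀ (by norm_num) (by positivity)]
    nlinarith
  linarith
end
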